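/- arXiv:1305.5295 — 2 statements merged into one kernel-verified Lean document; each statement's English description precedes it below -/
import Mathlib

section
/- Let F be a field of characteristic different from 2 which has the C_n property. Then k_{n+1}(F) = K_{n+1}^M(F)/2K_{n+1}^M(F) = 0. -/
universe u

open MvPolynomial

/-- A field `F` has the `C_n` property if every homogeneous polynomial of
positive degree `d` in more than `d ^ n` variables has a nontrivial zero. -/
def IsCField (F : Type u) [Field F] (n : ℕ) : Prop :=
  ∀ (d N : ℕ), 0 < d → d ^ n < N →
    ∀ f : MvPolynomial (Fin N) F, f.IsHomogeneous d →
      ∃ x : Fin N → F, x ≠ 0 ∧ MvPolynomial.eval x f = 0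

variable (F : Type u) [Field F]

/-- Multilinearity relations for Milnor K-theory. -/
def mlRel (n : ℕ) : Set (FreeAbelianGroup (Fin n → Fˣ)) :=
  {z | ∃ (a : Fin n → Fˣ) (i : Fin n) (u v : Fˣ), a i = u * v ∧
        z = FreeAbelianGroup.of a - FreeAbelianGroup.of (Function.update a i u)
              - FreeAbelianGroup.of (Function.update a i v)}

/-- Steinberg relations for Milnor K-theory. -/
def stRel (n : ℕ) : Set (FreeAbelianGroup (Fin n → Fˣ)) :=
  {z | ∃ (a : Fin n → Fˣ) (i j : Fin n), (i : ℕ) + 1 = (j : ℕ) ∧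
        ((a i : F) + (a j : F) = 1) ∧ z = FreeAbelianGroup.of a}

/-- The subgroup of relations defining the `n`-th Milnor K-group. -/
def milnorRel (n : ℕ) : AddSubgroup (FreeAbelianGroup (Fin n → Fˣ)) :=
  AddSubgroup.closure (mlRel F n ∪ stRel F n)

/-- The `n`-th Milnor K-group `K_n^M(F)`. -/
def MilnorK (n : ℕ) : Type u :=
  FreeAbelianGroup (Fin n → Fˣ) ⧸ milnorRel F n

instance (n : ℕ) : AddCommGroup (MilnorK F n) :=
  QuotientAddGroup.Quotient.addCommGroup _

/-- The subgroup `p·K_n^M(F)` of `K_n^M(F)`. -/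
def pMul (p n : ℕ) : AddSubgroup (MilnorK F n) :=
  AddSubgroup.closure {x | ∃ y : MilnorK F n, x = p • y}

/-- `k_n(F) = K_n^M(F)/pK_n^M(F)`. -/
def kMod (p n : ℕ) : Type u := MilnorK F n ⧸ pMul F p n

instance (p n : ℕ) : AddCommGroup (kMod F p n) :=
  QuotientAddGroup.Quotient.addCommGroup _

/-- The symbol `(a 1, …, a n)` in `k_n(F)`. -/
def symbol (p : ℕ) {n : ℕ} (a : Fin n → Fˣ) : kMod F p n :=
  QuotientAddGroup.mk (QuotientAddGroup.mk (FreeAbelianGroup.of a))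

/-- A function on lists of units that is multilinear, satisfies the Steinberg relation for
neighbouring entries, and takes `2`-torsion values. -/
structure IsSteinbergModTwo {F : Type u} [Field F] {A : Type*} [AddCommGroup A]
    (g : List Fˣ → A) : Prop where
  mul : ∀ (l r : List Fˣ) (x y : Fˣ), g (l ++ (x * y) :: r) = g (l ++ x :: r) + g (l ++ y :: r)
  steinberg : ∀ (l r : List Fˣ) (x y : Fˣ), (x : F) + y = 1 → g (l ++ x :: y :: r) = 0
  two_torsion : ∀ l, g l + g l = 0

namespace IsSteinbergModTwo

variable {F : Type u} [Field F] {A : Type*} [AddCommGroup A] {g : List Fˣ → A}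

theorem one (hg : IsSteinbergModTwo g) (l r : List Fˣ) : g (l ++ 1 :: r) = 0 := by
  simpa using hg.mul l r 1 1

theorem inv (hg : IsSteinbergModTwo g) (l r : List Fˣ) (x : Fˣ) :
    g (l ++ x⁻¹ :: r) = -g (l ++ x :: r) := by
  have h := hg.mul l r x⁻¹ x
  rw [inv_mul_cancel, hg.one] at h
  exact eq_neg_of_add_eq_zero_left h.symm

theorem mul_right (hg : IsSteinbergModTwo g) (l r : List Fˣ) (z x y : Fˣ) :
    g (l ++ z :: (x * y) :: r) = g (l ++ z :: x :: r) + g (l ++ z :: y :: r) := by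
  simpa using hg.mul (l ++ [z]) r x y

theorem inv_right (hg : IsSteinbergModTwo g) (l r : List Fˣ) (z x : Fˣ) :
    g (l ++ z :: x⁻¹ :: r) = -g (l ++ z :: x :: r) := by
  simpa using hg.inv (l ++ [z]) r x

theorem self_neg (hg : IsSteinbergModTwo g) (l r : List Fˣ) (x : Fˣ) :
    g (l ++ x :: (-x) :: r) = 0 := by
  by_cases hx : x = 1
  · rw [hx, hg.one]
  have hx' : (x : F) ≠ 1 := fun h => hx (Units.ext h)
  have hx0 : (x : F) ≠ 0 := x.ne_zero
  have h1 : (1 : F) - x ≠ 0 := sub_ne_zero.2 hx'.symm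
  have h2 : (1 : F) - (x : F)⁻¹ ≠ 0 := by
    rw [sub_ne_zero]
    intro h
    exact hx' (inv_eq_one.1 h.symm)
  have e : -x = Units.mk0 _ h1 * (Units.mk0 _ h2)⁻¹ := by
    ext
    simp only [Units.val_neg, Units.val_mul, Units.val_mk0, Units.val_inv_eq_inv_val]
    rw [eq_mul_inv_iff_mul_eq₀ h2]
    field_simp
    ring
  rw [e, hg.mul_right, hg.inv_right, hg.steinberg l r x _ (by simp), zero_add, ← hg.inv,
    hg.steinberg l r _ _ (by simp)]

theorem swap (hg : IsSteinbergModTwo g) (l r : List Fˣ) (x y : Fˣ) :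
    g (l ++ x :: y :: r) = g (l ++ y :: x :: r) := by
  have h := hg.self_neg l r (x * y)
  have hx := hg.self_neg l r x
  have hy := hg.self_neg l r y
  have e1 : -(x * y) = -x * y := by simp
  have e2 : -(x * y) = -y * x := by simp [mul_comm]
  rw [hg.mul] at h
  nth_rw 1 [e1] at h
  rw [e2, hg.mul_right, hg.mul_right, hx, hy, zero_add, zero_add] at h
  exact (eq_neg_of_add_eq_zero_left h).trans
    (eq_neg_of_add_eq_zero_left (hg.two_torsion _)).symm

theorem perm (hg : IsSteinbergModTwo g) {r s : List Fˣ} (h : r.Perm s) : g r = g s := by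
  suffices ∀ l, g (l ++ r) = g (l ++ s) from this []
  induction h with
  | nil => simp
  | cons x _ ih => intro l; simpa using ih (l ++ [x])
  | swap x y r => intro l; exact hg.swap l r y x
  | trans _ _ ih₁ ih₂ => intro l; exact (ih₁ l).trans (ih₂ l)

/-- If `b = p - a * q` and the symbols `(p, x, T)`, `(q, x, T)` vanish for all `x`, then
`(b, a, T)` vanishes. -/
theorem eq_zero_of_eq_sub (hg : IsSteinbergModTwo g) (T : List Fˣ) (a b p q : Fˣ)
    (hp : ∀ x, g (p :: x :: T) = 0) (hq : ∀ x, g (q :: x :: T) = 0)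
    (hb : (b : F) = p - a * q) : g (b :: a :: T) = 0 := by
  have hswap := hg.swap [] T
  have hmul := fun x y z => hg.mul [] (z :: T) x y
  have hinv := fun x z => hg.inv [] (z :: T) x
  have hmul' := hg.mul_right [] T
  have hinv' := hg.inv_right [] T
  simp only [List.nil_append] at hswap hmul hmul' hinv hinv'
  have h := hg.steinberg [] T (a * q * p⁻¹) (b * p⁻¹) (by
    have := p.ne_zero
    simp only [Units.val_mul, Units.val_inv_eq_inv_val, hb]
    field_simp
    ring)
  rw [List.nil_append, hmul, hmul, hinv, hp, hq, hmul', hinv', hswap a p, hp, hswap a b] at h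
  simpa using h

/-- For each list `l = [a₁, …, aₖ]` there is a diagonal quadratic form of dimension `2 ^ k`
(the Pfister form `⟨⟨a₁, …, aₖ⟩⟩`) such that symbols `(b, a₁, …, aₖ, …)` vanish whenever `b` is
represented by the form, and symbols `(a₁, …, aₖ, …)` vanish whenever the form is isotropic. -/
theorem exists_pfister (hg : IsSteinbergModTwo g) (l : List Fˣ) :
    ∃ (ι : Type) (_ : Fintype ι) (c : ι → F), Fintype.card ι = 2 ^ l.length ∧
      ∀ (v : ι → F) (r : List Fˣ),
        (∀ b : Fˣ, ∑ i, c i * v i ^ 2 = b → g (b :: (l ++ r)) = 0) ∧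
        (v ≠ 0 → ∑ i, c i * v i ^ 2 = 0 → g (l ++ r) = 0) := by
  induction l with
  | nil =>
    refine ⟨Unit, inferInstance, fun _ => 1, by simp, fun v r => ⟨fun b hb => ?_, ?_⟩⟩
    · simp only [Finset.univ_unique, Finset.sum_singleton, one_mul] at hb
      have hv : v default ≠ 0 := by
        intro h
        exact b.ne_zero (by simp [← hb, h])
      have e : b = Units.mk0 _ hv * Units.mk0 _ hv := by ext; simp [← hb, sq]
      have h := hg.mul [] r (Units.mk0 _ hv) (Units.mk0 _ hv)
      rw [hg.two_torsion, ← e] at h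
      simpa using h
    · intro hv h
      simp only [Finset.univ_unique, Finset.sum_singleton, one_mul] at h
      exact absurd (funext fun i => by simpa using pow_eq_zero_iff two_ne_zero |>.1 h) hv
  | cons a l ih =>
    obtain ⟨ι, _, c, hcard, H⟩ := ih
    refine ⟨ι ⊕ ι, inferInstance, Sum.elim c fun i => -a * c i, ?_, fun v r => ?_⟩
    · rw [Fintype.card_sum, hcard, List.length_cons, pow_succ, mul_two]
    set p := ∑ i, c i * v (Sum.inl i) ^ 2 with hp
    set q := ∑ i, c i * v (Sum.inr i) ^ 2 with hq
    have hsum : ∑ i, Sum.elim c (fun i => -(a : F) * c i) i * v i ^ 2 = p - a * q := by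
      simp [Fintype.sum_sum_type, hp, hq, Finset.mul_sum, sub_eq_add_neg, mul_assoc]
    rw [hsum]
    have hP : ∀ (P : Fˣ), p = P → ∀ x, g (P :: x :: (l ++ r)) = 0 := fun P hP x => by
      rw [← (H _ (x :: r)).1 P (hp.symm.trans hP)]
      exact hg.perm (List.perm_middle.symm.cons P)
    have hQ : ∀ (Q : Fˣ), q = Q → ∀ x, g (Q :: x :: (l ++ r)) = 0 := fun Q hQ x => by
      rw [← (H _ (x :: r)).1 Q (hq.symm.trans hQ)]
      exact hg.perm (List.perm_middle.symm.cons Q)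
    refine ⟨fun b hb => ?_, fun hv h0 => ?_⟩
    · by_cases hq0 : q = 0
      · exact hP b (by simpa [hq0] using hb) a
      by_cases hp0 : p = 0
      · have e : b = -a * Units.mk0 q hq0 := by ext; simp [← hb, hp0]
        have h1 := hg.mul [] (a :: (l ++ r)) (-a) (Units.mk0 q hq0)
        have h2 := hg.self_neg [] (l ++ r) (-a)
        rw [neg_neg] at h2
        rw [← e, h2, zero_add] at h1
        exact h1.trans (hQ _ rfl a)
      · exact hg.eq_zero_of_eq_sub (l ++ r) a b (Units.mk0 p hp0) (Units.mk0 q hq0)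
          (hP _ rfl) (hQ _ rfl) hb.symm
    · by_cases hq0 : q = 0
      · have hp0 : p = 0 := by simpa [hq0] using h0
        have e : g (a :: l ++ r) = g (l ++ a :: r) := hg.perm List.perm_middle.symm
        rw [e]
        by_cases hl : (fun i => v (Sum.inl i)) = 0
        · refine (H (fun i => v (Sum.inr i)) (a :: r)).2 (fun hr => hv ?_) hq0
          ext (i | i)
          · exact congrFun hl i
          · exact congrFun hr i
        · exact (H _ (a :: r)).2 hl hp0
      · have hp0 : p ≠ 0 := by
          rw [sub_eq_zero.1 h0]
          exact mul_ne_zero a.ne_zero hq0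
        have e : a = Units.mk0 p hp0 * (Units.mk0 q hq0)⁻¹ := by
          ext
          simp [sub_eq_zero.1 h0]
        have h1 := (H _ r).1 (Units.mk0 p hp0) rfl
        have h2 := (H _ r).1 (Units.mk0 q hq0) rfl
        have h3 := hg.mul [] (l ++ r) (Units.mk0 p hp0) (Units.mk0 q hq0)⁻¹
        rw [← e, hg.inv] at h3
        simp only [List.nil_append, h1, h2] at h3
        simpa using h3

end IsSteinbergModTwo

/-- A `C_n` field has a nontrivial zero of every diagonal quadratic form in more than `2 ^ n`
variables. -/
theorem IsCField.exists_diagonal_zero {F : Type u} [Field F] {n : ℕ} (hC : IsCField F n)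
    {ι : Type} [Fintype ι] (hι : 2 ^ n < Fintype.card ι) (c : ι → F) :
    ∃ v : ι → F, v ≠ 0 ∧ ∑ i, c i * v i ^ 2 = 0 := by
  let e := Fintype.equivFin ι
  obtain ⟨x, hx, h⟩ := hC 2 _ two_pos hι (∑ i, C (c (e.symm i)) * X i ^ 2)
    (IsHomogeneous.sum _ _ _ fun i _ => by
      simpa using (isHomogeneous_C _ _).mul ((isHomogeneous_X F i).pow 2))
  refine ⟨x ∘ e, fun h0 => hx ?_, ?_⟩
  · ext i
    simpa using congrFun h0 (e.symm i)
  · rw [← h, ← e.sum_comp]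
    simp

theorem IsSteinbergModTwo.eq_zero_of_isCField {F : Type u} [Field F] {A : Type*} [AddCommGroup A]
    {g : List Fˣ → A} (hg : IsSteinbergModTwo g) {n : ℕ} (hC : IsCField F n) (l : List Fˣ)
    (hl : l.length = n + 1) : g l = 0 := by
  obtain _ | ⟨b, l⟩ := l
  · simp at hl
  obtain ⟨ι, _, c, hcard, H⟩ := hg.exists_pfister l
  obtain ⟨v, hv, h0⟩ := hC.exists_diagonal_zero (ι := Option ι)
    (by rw [Fintype.card_option, hcard]; simp_all) (fun i => i.elim (-(b : F)) c)
  simp only [Fintype.sum_option, Option.elim_none, Option.elim_some] at h0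
  by_cases hn : v none = 0
  · have h1 := (H (fun i => v (some i)) [b]).2
      (fun hs => hv (by ext (_ | i); exacts [hn, congrFun hs i])) (by simpa [hn] using h0)
    rw [← h1]
    exact hg.perm (List.perm_append_singleton b l).symm
  · let w := Units.mk0 _ hn
    have h1 := (H (fun i => v (some i)) []).1 (b * (w * w)) (by
      simp only [w, Units.val_mul, Units.val_mk0]
      linear_combination h0)
    have h2 := hg.mul [] l b (w * w)
    rw [hg.mul [] l w w, hg.two_torsion, add_zero] at h2
    simpa using h2.symm.trans (by simpa using h1)

/-- The symbol in `k_m(F)` of a list of units, zero if the list does not have length `m`. -/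
def listSymbol (F : Type u) [Field F] (p m : ℕ) (l : List Fˣ) : kMod F p m :=
  if h : l.length = m then symbol F p (fun i : Fin m => l[i]) else 0

/-- The quotient map from the free abelian group on tuples to `k_m(F)`. -/
def symbolHom (F : Type u) [Field F] (p m : ℕ) : FreeAbelianGroup (Fin m → Fˣ) →+ kMod F p m :=
  (QuotientAddGroup.mk' (pMul F p m)).comp (QuotientAddGroup.mk' (milnorRel F m))

theorem symbolHom_eq_zero {F : Type u} [Field F] {p m : ℕ} {z : FreeAbelianGroup (Fin m → Fˣ)}
    (hz : z ∈ mlRel F m ∪ stRel F m) : symbolHom F p m z = 0 := by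
  have h : QuotientAddGroup.mk' (milnorRel F m) z = 0 :=
    (QuotientAddGroup.eq_zero_iff z).2 (AddSubgroup.subset_closure hz)
  exact (congrArg (QuotientAddGroup.mk' (pMul F p m)) h).trans (map_zero _)

theorem nsmul_kMod_eq_zero {F : Type u} [Field F] {p m : ℕ} (α : kMod F p m) : p • α = 0 := by
  obtain ⟨y, rfl⟩ := QuotientAddGroup.mk'_surjective (pMul F p m) α
  exact (map_nsmul (QuotientAddGroup.mk' (pMul F p m)) p y).symm.trans
    ((QuotientAddGroup.eq_zero_iff _).2 (AddSubgroup.subset_closure ⟨y, rfl⟩))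

theorem isSteinbergModTwo_listSymbol (F : Type u) [Field F] (m : ℕ) :
    IsSteinbergModTwo (listSymbol F 2 m) where
  mul l r x y := by
    by_cases h : (l ++ (x * y) :: r).length = m
    · have hx : (l ++ x :: r).length = m := by simpa using h
      have hy : (l ++ y :: r).length = m := by simpa using h
      have hi : l.length < m := by rw [← h]; simp
      have key : ∀ (z : Fˣ) (hz : (l ++ z :: r).length = m),
          Function.update (fun i : Fin m => (l ++ (x * y) :: r)[i]) ⟨l.length, hi⟩ z =
            fun i : Fin m => (l ++ z :: r)[i] := by
        intro z hz
        ext i : 1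
        by_cases hil : i = ⟨l.length, hi⟩
        · subst hil
          simp
        · have : (i : ℕ) ≠ l.length := fun e => hil (Fin.ext e)
          rw [Function.update_of_ne hil]
          simp only [Fin.getElem_fin]
          grind
      have h0 := symbolHom_eq_zero (p := 2) (Or.inl ⟨fun i : Fin m => (l ++ (x * y) :: r)[i],
        ⟨l.length, hi⟩, x, y, by simp, rfl⟩)
      rw [key x hx, key y hy, map_sub, map_sub, sub_sub, sub_eq_zero] at h0
      rw [listSymbol, listSymbol, listSymbol, dif_pos h, dif_pos hx, dif_pos hy]
      exact h0
    · have hx : ¬ (l ++ x :: r).length = m := by simpa using h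
      have hy : ¬ (l ++ y :: r).length = m := by simpa using h
      rw [listSymbol, listSymbol, listSymbol, dif_neg h, dif_neg hx, dif_neg hy, add_zero]
  steinberg l r x y hxy := by
    rw [listSymbol]
    split_ifs with h
    · have hm : l.length + 1 < m := by rw [← h]; simp
      exact symbolHom_eq_zero (p := 2) (Or.inr ⟨fun i : Fin m => (l ++ x :: y :: r)[i],
        ⟨l.length, by lia⟩, ⟨l.length + 1, hm⟩, rfl, by simpa using hxy, rfl⟩)
    · rfl
  two_torsion l := by rw [← two_nsmul, nsmul_kMod_eq_zero]

/-- If `F` is a field of characteristic different from `2`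
with the `C_n` property, then `k_{n+1}(F) = K_{n+1}^M(F)/2K_{n+1}^M(F) = 0`. -/
theorem kMod_succ_eq_zero (F : Type u) [Field F] (n : ℕ)
    (hchar : ringChar F ≠ 2) (hC : IsCField F n) :
    ∀ α : kMod F 2 (n + 1), α = 0 := by
  intro α
  obtain ⟨y, rfl⟩ := QuotientAddGroup.mk'_surjective (pMul F 2 (n + 1)) α
  obtain ⟨z, rfl⟩ := QuotientAddGroup.mk'_surjective (milnorRel F (n + 1)) y
  have h : symbolHom F 2 (n + 1) = 0 := by
    ext a
    have h0 := (isSteinbergModTwo_listSymbol F (n + 1)).eq_zero_of_isCField hC (List.ofFn a)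
      (by simp)
    rw [listSymbol, dif_pos (by simp)] at h0
    simp only [Fin.getElem_fin, List.getElem_ofFn, Fin.eta] at h0
    exact h0
  exact DFunLike.congr_fun h z
end

section
/- Let F be a field with the C_2 property and let p be a prime not equal to the characteristic of F. Then K_3^M(F)/pK_3^M(F) = 0. -/
universe u

open MvPolynomial

variable (F : Type u) [Field F]

/-! ### The Milnor ring of a domain -/

namespace MilnorRing

/-- Defining relations of the Milnor ring of (the fraction field of) a domain `R`, in terms of
symbols of elements of `R`. -/
inductive Rel (R : Type*) [CommRing R] : FreeAlgebra ℤ R → FreeAlgebra ℤ R → Prop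
  | zero : Rel R (FreeAlgebra.ι ℤ 0) 0
  | mul (x y : R) (hx : x ≠ 0) (hy : y ≠ 0) :
      Rel R (FreeAlgebra.ι ℤ (x * y)) (FreeAlgebra.ι ℤ x + FreeAlgebra.ι ℤ y)
  | steinberg (x y : R) (hx : x ≠ 0) (hy : y ≠ 0) (hxy : x + y ≠ 0) :
      Rel R ((FreeAlgebra.ι ℤ x - FreeAlgebra.ι ℤ (x + y)) *
        (FreeAlgebra.ι ℤ y - FreeAlgebra.ι ℤ (x + y))) 0

end MilnorRing

/-- The Milnor ring of (the fraction field of) a domain `R`. -/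
def MilnorRing (R : Type*) [CommRing R] : Type _ := RingQuot (MilnorRing.Rel R)

namespace MilnorRing

noncomputable instance (R : Type*) [CommRing R] : Ring (MilnorRing R) :=
  inferInstanceAs (Ring (RingQuot (MilnorRing.Rel R)))

/-- The symbol of length one attached to an element (zero if the element is zero). -/
noncomputable def sym {R : Type*} [CommRing R] (x : R) : MilnorRing R :=
  RingQuot.mkRingHom (Rel R) (FreeAlgebra.ι ℤ x)

section Basic

variable {R : Type*} [CommRing R]

@[simp] lemma sym_zero : sym (0 : R) = 0 := by
  have := RingQuot.mkRingHom_rel (Rel.zero (R := R))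
  rwa [map_zero] at this

lemma sym_mul {x y : R} (hx : x ≠ 0) (hy : y ≠ 0) : sym (x * y) = sym x + sym y := by
  have := RingQuot.mkRingHom_rel (Rel.mul x y hx hy)
  rwa [map_add] at this

lemma sym_steinberg {x y : R} (hx : x ≠ 0) (hy : y ≠ 0) (hxy : x + y ≠ 0) :
    (sym x - sym (x + y)) * (sym y - sym (x + y)) = 0 := by
  have := RingQuot.mkRingHom_rel (Rel.steinberg x y hx hy hxy)
  rwa [map_zero, map_mul, map_sub, map_sub] at this

/-- The universal property of the Milnor ring. -/
noncomputable def lift {A : Type*} [Ring A] (s : R → A) (h0 : s 0 = 0)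
    (hmul : ∀ x y, x ≠ 0 → y ≠ 0 → s (x * y) = s x + s y)
    (hst : ∀ x y, x ≠ 0 → y ≠ 0 → x + y ≠ 0 → (s x - s (x + y)) * (s y - s (x + y)) = 0) :
    MilnorRing R →+* A :=
  RingQuot.lift ⟨(FreeAlgebra.lift ℤ s).toRingHom, by
    intro _ _ h
    cases h with
    | zero => simpa using h0
    | mul x y hx hy => simpa using hmul x y hx hy
    | steinberg x y hx hy hxy => simpa using hst x y hx hy hxy⟩

@[simp] lemma lift_sym {A : Type*} [Ring A] (s : R → A) (h0 hmul hst) (x : R) :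
    lift s h0 hmul hst (sym x) = s x := by
  unfold lift sym
  erw [RingQuot.lift_mkRingHom_apply]
  simp

lemma closure_range_sym : Subring.closure (Set.range (sym : R → MilnorRing R)) = ⊤ := by
  refine eq_top_iff.mpr fun x _ => ?_
  obtain ⟨y, rfl⟩ := RingQuot.mkRingHom_surjective (Rel R) x
  induction y using FreeAlgebra.induction with
  | grade0 n =>
    have : (RingQuot.mkRingHom (Rel R)) (algebraMap ℤ (FreeAlgebra ℤ R) n) =
      ((n : ℤ) : RingQuot (Rel R)) := by simp
    rw [this]
    exact intCast_mem (Subring.closure (Set.range (sym : R → MilnorRing R))) n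
  | grade1 r => exact Subring.subset_closure ⟨r, rfl⟩
  | mul a b ha hb => rw [map_mul]; exact mul_mem (ha trivial) (hb trivial)
  | add a b ha hb => rw [map_add]; exact add_mem (ha trivial) (hb trivial)

lemma ringHom_ext {A : Type*} [Ring A] {f g : MilnorRing R →+* A}
    (h : ∀ x, f (sym x) = g (sym x)) : f = g := by
  ext x
  have hx : x ∈ Subring.closure (Set.range (sym : R → MilnorRing R)) := by
    rw [closure_range_sym]; trivial
  induction hx using Subring.closure_induction with
  | mem x hx => obtain ⟨y, rfl⟩ := hx; exact h y
  | zero => simp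
  | one => simp
  | add x y _ _ hx hy => simp [hx, hy]
  | neg x _ hx => simp [hx]
  | mul x y _ _ hx hy => simp [hx, hy]

/-- Functoriality for injective homomorphisms. -/
noncomputable def map {S : Type*} [CommRing S] (φ : R →+* S) (hφ : Function.Injective φ) :
    MilnorRing R →+* MilnorRing S :=
  lift (fun x => sym (φ x)) (by simp)
    (fun x y hx hy => by
      rw [map_mul]
      exact sym_mul ((map_ne_zero_iff φ hφ).mpr hx) ((map_ne_zero_iff φ hφ).mpr hy))
    (fun x y hx hy hxy => by
      rw [map_add]
      refine sym_steinberg ((map_ne_zero_iff φ hφ).mpr hx) ((map_ne_zero_iff φ hφ).mpr hy) ?_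
      rw [← map_add]
      exact (map_ne_zero_iff φ hφ).mpr hxy)

@[simp] lemma map_sym {S : Type*} [CommRing S] (φ : R →+* S) (hφ : Function.Injective φ) (x : R) :
    map φ hφ (sym x) = sym (φ x) := by
  simp [map]

end Basic

section Domain

variable {R : Type*} [CommRing R] [IsDomain R]

@[simp] lemma sym_one : sym (1 : R) = 0 := by
  have := sym_mul (one_ne_zero (α := R)) one_ne_zero
  rw [mul_one] at this
  simpa using this

lemma sym_pow {x : R} (hx : x ≠ 0) (n : ℕ) : sym (x ^ n) = n • sym x := by
  induction n with
  | zero => simp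
  | succ n ih => rw [pow_succ, sym_mul (pow_ne_zero n hx) hx, ih, succ_nsmul]

lemma sym_neg_one_add_self : sym (-1 : R) + sym (-1 : R) = 0 := by
  rw [← sym_mul (by simp) (by simp)]; simp

lemma sym_neg {x : R} (hx : x ≠ 0) : sym (-x) = sym (-1) + sym x := by
  rw [← sym_mul (by simp) hx]; simp

lemma sym_mul_sym_neg {x : R} (hx : x ≠ 0) : sym x * sym (-x) = 0 := by
  by_cases h1 : x = 1
  · simp [h1]
  have hx1 : x - 1 ≠ 0 := sub_ne_zero.mpr h1
  have hx2 : -(x - 1) ≠ 0 := neg_ne_zero.mpr hx1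
  have e1 := sym_steinberg hx hx2 (by simp)
  have e2 := sym_steinberg (one_ne_zero (α := R)) hx1 (by simpa using hx)
  rw [sym_neg hx1] at e1
  simp only [sym_one, add_sub_cancel, zero_sub, show x + -(x - 1) = 1 by ring, sub_zero] at e1 e2
  rw [sym_neg hx]
  rw [mul_add] at e1 ⊢
  rw [neg_mul, mul_sub, neg_sub, sub_eq_zero] at e2
  rw [e2]; exact e1

lemma sym_mul_comm {x y : R} (hx : x ≠ 0) (hy : y ≠ 0) : sym x * sym y = -(sym y * sym x) := by
  have h := sym_mul_sym_neg (mul_ne_zero hx hy)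
  have h1 := sym_mul_sym_neg hx
  have h2 := sym_mul_sym_neg hy
  rw [← neg_mul, sym_mul hx hy, sym_mul (neg_ne_zero.mpr hx) hy] at h
  rw [sym_neg hy] at h2
  have h3 : (sym x + sym y) * (sym (-x) + sym y) =
    sym x * sym (-x) + (sym x * sym y + sym y * sym x) + sym y * (sym (-1) + sym y) := by
    rw [sym_neg hx]; noncomm_ring
  rw [h3, h1, h2, zero_add, add_zero] at h
  exact eq_neg_of_add_eq_zero_left h

lemma sym_mul_self {x : R} (hx : x ≠ 0) : sym x * sym x = sym x * sym (-1) := by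
  have h := sym_mul_sym_neg hx
  rw [sym_neg hx, mul_add] at h
  rw [← add_right_inj (sym x * sym (-1)), h, ← mul_add, sym_neg_one_add_self, mul_zero]

end Domain

end MilnorRing

/-! ### Comparison with the Milnor K-groups modulo `p` -/

section Comparison

variable {F}

/-- Left multiplication by `{a}` on Milnor K-groups. -/
def milnorCons (a : Fˣ) (n : ℕ) : MilnorK F n →+ MilnorK F (n + 1) :=
  QuotientAddGroup.map (milnorRel F n) (milnorRel F (n + 1))
    (FreeAbelianGroup.map (fun b : Fin n → Fˣ => (Fin.cons a b : Fin (n + 1) → Fˣ))) (by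
      rw [milnorRel, AddSubgroup.closure_le]
      rintro z (⟨b, i, s, t, hi, rfl⟩ | ⟨b, i, j, hij, hb, rfl⟩)
      · refine AddSubgroup.subset_closure (Or.inl ⟨Fin.cons a b, i.succ, s, t,
          by simpa using hi, ?_⟩)
        simp [Fin.cons_update]
      · refine AddSubgroup.subset_closure (Or.inr ⟨Fin.cons a b, i.succ, j.succ, by simpa using hij,
          by simpa using hb, ?_⟩)
        simp)

/-- Left multiplication by `{a}` on Milnor K-groups modulo `p`. -/
def kModCons (p : ℕ) (a : Fˣ) (n : ℕ) : kMod F p n →+ kMod F p (n + 1) :=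
  QuotientAddGroup.map (pMul F p n) (pMul F p (n + 1)) (milnorCons a n) (by
    rw [pMul, AddSubgroup.closure_le]
    rintro z ⟨y, rfl⟩
    exact AddSubgroup.subset_closure ⟨milnorCons a n y, map_nsmul _ _ _⟩)

lemma kModCons_symbol (p : ℕ) (a : Fˣ) (n : ℕ) (b : Fin n → Fˣ) :
    kModCons p a n (symbol F p b) = symbol F p (Fin.cons a b : Fin (n + 1) → Fˣ) := rfl

lemma kMod_induction (p : ℕ) {n : ℕ} {P : kMod F p n → Prop} (h0 : P 0)
    (hs : ∀ a, P (symbol F p a)) (hneg : ∀ x, P x → P (-x))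
    (hadd : ∀ x y, P x → P y → P (x + y)) (x : kMod F p n) : P x := by
  obtain ⟨x, rfl⟩ := QuotientAddGroup.mk_surjective x
  obtain ⟨x, rfl⟩ := QuotientAddGroup.mk_surjective x
  induction x using FreeAbelianGroup.induction_on with
  | zero => exact h0
  | of a => exact hs a
  | neg a h => exact hneg _ h
  | add a b ha hb => exact hadd _ _ ha hb

lemma nsmul_kMod_eq_zero_s3 (p n : ℕ) (x : kMod F p n) : p • x = 0 := by
  obtain ⟨x, rfl⟩ := QuotientAddGroup.mk_surjective x
  exact (QuotientAddGroup.eq_zero_iff (N := pMul F p n) (p • x)).mpr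
    (AddSubgroup.subset_closure ⟨x, rfl⟩)

lemma symbol_update_mul (p : ℕ) {n : ℕ} (a : Fin n → Fˣ) (i : Fin n) (s t : Fˣ)
    (h : a i = s * t) : symbol F p a =
      symbol F p (Function.update a i s) + symbol F p (Function.update a i t) := by
  have h1 : (QuotientAddGroup.mk (FreeAbelianGroup.of a) : MilnorK F n) -
      QuotientAddGroup.mk (FreeAbelianGroup.of (Function.update a i s)) -
      QuotientAddGroup.mk (FreeAbelianGroup.of (Function.update a i t)) = 0 :=
    (QuotientAddGroup.eq_zero_iff (N := milnorRel F n) _).mpr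
      (AddSubgroup.subset_closure (Or.inl ⟨a, i, s, t, h, rfl⟩))
  rw [sub_sub, sub_eq_zero] at h1
  exact congrArg (QuotientAddGroup.mk : MilnorK F n → kMod F p n) h1

lemma symbol_eq_zero_of_add_eq_one (p : ℕ) {n : ℕ} (a : Fin n → Fˣ) (i j : Fin n)
    (hij : (i : ℕ) + 1 = j) (h : (a i : F) + a j = 1) : symbol F p a = 0 := by
  have h1 : (QuotientAddGroup.mk (FreeAbelianGroup.of a) : MilnorK F n) = 0 :=
    (QuotientAddGroup.eq_zero_iff (N := milnorRel F n) _).mpr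
      (AddSubgroup.subset_closure (Or.inr ⟨a, i, j, hij, h, rfl⟩))
  exact congrArg (QuotientAddGroup.mk : MilnorK F n → kMod F p n) h1

lemma kModCons_mul (p : ℕ) (a b : Fˣ) (n : ℕ) (x : kMod F p n) :
    kModCons p (a * b) n x = kModCons p a n x + kModCons p b n x := by
  induction x using kMod_induction with
  | h0 => simp
  | hs c =>
    simp only [kModCons_symbol]
    rw [symbol_update_mul p (Fin.cons (a * b) c : Fin (n + 1) → Fˣ) 0 a b rfl]
    simp only [Fin.update_cons_zero]
  | hneg x h => simp only [map_neg, h]; abel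
  | hadd x y hx hy => simp only [map_add, hx, hy]; abel

lemma kModCons_kModCons (p : ℕ) (a b : Fˣ) (h : (a : F) + b = 1) (n : ℕ) (x : kMod F p n) :
    kModCons p a (n + 1) (kModCons p b n x) = 0 := by
  induction x using kMod_induction with
  | h0 => simp
  | hs c =>
    simp only [kModCons_symbol]
    exact symbol_eq_zero_of_add_eq_one p _ 0 1 rfl (by simpa using h)
  | hneg x h => simp only [map_neg, h]; simp
  | hadd x y hx hy => simp only [map_add, hx, hy]; simp

/-- Left multiplication by `{a}` on the product of all Milnor K-groups modulo `p`. -/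
def kModShift (p : ℕ) (a : Fˣ) : AddMonoid.End (∀ n, kMod F p n) where
  toFun w := fun n => match n with
    | 0 => 0
    | n + 1 => kModCons p a n (w n)
  map_zero' := by
    funext n
    cases n <;> simp
  map_add' v w := by
    funext n
    cases n <;> simp

lemma kModShift_mul (p : ℕ) (a b : Fˣ) :
    kModShift p (a * b) = kModShift p a + kModShift p b := by
  ext w n
  cases n with
  | zero => exact (add_zero 0).symm
  | succ n => exact kModCons_mul p a b n (w n)

lemma kModShift_mul_kModShift (p : ℕ) (a b : Fˣ) (h : (a : F) + b = 1) :
    kModShift p a * kModShift p b = 0 := by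
  ext w n
  match n with
  | 0 => rfl
  | 1 => exact map_zero (kModCons p a 0)
  | n + 2 => exact kModCons_kModCons p a b h n (w n)

open Classical in
/-- The action of the Milnor ring on the product of all Milnor K-groups modulo `p`. -/
noncomputable def milnorRingToEnd (p : ℕ) : MilnorRing F →+* AddMonoid.End (∀ n, kMod F p n) :=
  MilnorRing.lift (fun x => if h : x = 0 then 0 else kModShift p (Units.mk0 x h)) (by simp)
    (fun x y hx hy => by
      simp only [hx, hy, mul_eq_zero, or_self, dite_false, Units.mk0_mul, kModShift_mul])
    (fun x y hx hy hxy => by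
      simp only [hx, hy, hxy, dite_false]
      have key : ∀ (z : F) (hz : z ≠ 0), kModShift p (Units.mk0 z hz) -
          kModShift p (Units.mk0 (x + y) hxy) =
          kModShift p (Units.mk0 (z / (x + y)) (div_ne_zero hz hxy)) := by
        intro z hz
        rw [sub_eq_iff_eq_add, ← kModShift_mul]
        congr 1
        ext
        simp [div_mul_cancel₀ z hxy]
      rw [key, key]
      exact kModShift_mul_kModShift p _ _ (by simp; field_simp))

lemma milnorRingToEnd_sym (p : ℕ) (a : Fˣ) :
    milnorRingToEnd p (MilnorRing.sym (a : F)) = kModShift p a := by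
  simp [milnorRingToEnd]

lemma symbol_eq_zero_of_eq_nsmul (p : ℕ) (a b c : Fˣ) (z : MilnorRing F)
    (h : MilnorRing.sym (a : F) * (MilnorRing.sym (b : F) * MilnorRing.sym (c : F)) = p • z) :
    symbol F p ![a, b, c] = 0 := by
  have h1 := congrArg (fun x => milnorRingToEnd p x (Pi.single 0 (symbol F p ![])) 3) h
  simp only [map_mul, map_nsmul, milnorRingToEnd_sym] at h1
  have h2 : (p • milnorRingToEnd p z) (Pi.single 0 (symbol F p ![])) 3 = 0 :=
    nsmul_kMod_eq_zero_s3 p 3 (milnorRingToEnd p z (Pi.single 0 (symbol F p ![])) 3)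
  rw [h2] at h1
  exact h1

end Comparison

/-! ### Residue maps -/

/-- The order and leading coefficient functions of a discrete valuation with a chosen
uniformizer, restricted to a domain `R`. -/
structure TameDatum (R k : Type*) [CommRing R] [Field k] where
  ord : R → ℤ
  lc : R → k
  ord_zero : ord 0 = 0
  lc_zero : lc 0 = 0
  lc_ne_zero : ∀ x, x ≠ 0 → lc x ≠ 0
  ord_mul : ∀ x y, x ≠ 0 → y ≠ 0 → ord (x * y) = ord x + ord y
  lc_mul : ∀ x y, x ≠ 0 → y ≠ 0 → lc (x * y) = lc x * lc y
  add : ∀ x y, x ≠ 0 → y ≠ 0 → x + y ≠ 0 →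
    (ord x = ord (x + y) ∧ lc x = lc (x + y)) ∨ (ord y = ord (x + y) ∧ lc y = lc (x + y)) ∨
    (ord x = ord (x + y) ∧ ord y = ord (x + y) ∧ lc x + lc y = lc (x + y)) ∨
    (ord x = ord y ∧ lc x = - lc y)

namespace TameDatum

open MilnorRing

variable {R k : Type*} [CommRing R] [Field k] (D : TameDatum R k)

/-- The matrix by which a symbol of length one acts in the target of the residue map. -/
noncomputable def mat (c : k) (n : ℤ) : Matrix (Fin 2) (Fin 2) (MilnorRing k) :=
  !![sym c, 0; (n : MilnorRing k), n • sym (-1) - sym c]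

lemma mat_mul_eq_add {c d : k} (hc : c ≠ 0) (hd : d ≠ 0) (m n : ℤ) :
    mat (c * d) (m + n) = mat c m + mat d n := by
  ext i j
  fin_cases i <;> fin_cases j
  · simp [mat, sym_mul hc hd]
  · simp [mat]
  · simp [mat]
  · simp only [mat, sym_mul hc hd, Fin.mk_one, Matrix.of_apply, Matrix.cons_val',
      Matrix.cons_val_one,
      Matrix.cons_val_fin_one, Matrix.add_apply]
    module

lemma mat_sub {c d : k} (hc : c ≠ 0) (hd : d ≠ 0) (m n : ℤ) :
    mat c m - mat d n = mat (c / d) (m - n) := by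
  rw [sub_eq_iff_eq_add, ← mat_mul_eq_add (div_ne_zero hc hd) hd, div_mul_cancel₀ c hd,
    sub_add_cancel]

lemma mat_mul_mat_of_add_eq_one {c d : k} (hc : c ≠ 0) (hd : d ≠ 0) (h : c + d = 1) :
    mat c 0 * mat d 0 = 0 := by
  have h1 := sym_steinberg hc hd (by simp [h])
  simp only [h, sym_one, sub_zero] at h1
  ext i j
  fin_cases i <;> fin_cases j <;> simp [mat, h1]

lemma mat_mul_mat_neg {c : k} (hc : c ≠ 0) (n : ℤ) : mat c n * mat (-c) n = 0 := by
  have h1 := sym_mul_sym_neg hc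
  have h2 : sym (-1 : k) + sym (-1 : k) = 0 := sym_neg_one_add_self
  have h3 : sym (-1 : k) * sym (-1 : k) + sym (-1 : k) * sym (-1 : k) = 0 := by
    rw [← mul_add, h2, mul_zero]
  have h4 : sym (-1 : k) * sym c = - (sym c * sym (-1)) := sym_mul_comm (by simp) hc
  have h6 : ∀ x : MilnorRing k, x * (n : MilnorRing k) = n • x := fun x => by
    rw [zsmul_eq_mul, Int.cast_comm]
  have h8 : ∀ x : MilnorRing k, x + x = 0 → (n * n + n) • x = 0 := fun x hx => by
    obtain ⟨r, hr⟩ := Int.even_mul_succ_self n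
    rw [show n * n + n = r + r by rw [← hr]; ring, add_smul, ← smul_add, hx, smul_zero]
  have hm := h8 _ h2
  have hmm := h8 _ h3
  rw [sym_neg hc, mul_add] at h1
  simp only [mat, Matrix.mul_fin_two, sym_neg hc]
  have e1 : n • (sym (-1) + sym c) + (n • sym (-1) - sym c) * (n : MilnorRing k) = 0 := by
    rw [h6, ← hm]
    module
  have e2 : (n • sym (-1) - sym c) * (n • sym (-1) - (sym (-1) + sym c)) = 0 := by
    simp only [sub_mul, mul_sub, mul_add, smul_mul_assoc, mul_smul_comm, h4]
    have h9 : sym c * sym c = - (sym c * sym (-1)) := (neg_eq_of_add_eq_zero_right h1).symm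
    have h10 : n • n • (sym (-1 : k) * sym (-1)) - n • (sym (-1 : k) * sym (-1)) =
        (n * n + n) • (sym (-1 : k) * sym (-1)) -
          n • (sym (-1 : k) * sym (-1) + sym (-1) * sym (-1)) := by module
    rw [hmm, h3, smul_zero, sub_zero] at h10
    rw [h9, ← h10]
    module
  rw [e2]
  ext i j
  fin_cases i <;> fin_cases j
  · simp [mul_add, h1]
  · simp
  · simpa [mul_add] using e1
  · simp

/-- The total residue homomorphism. -/
noncomputable def resMat : MilnorRing R →+* Matrix (Fin 2) (Fin 2) (MilnorRing k) :=
  lift (fun x => mat (D.lc x) (D.ord x))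
    (by
      rw [D.lc_zero, D.ord_zero]
      ext i j
      fin_cases i <;> fin_cases j <;> simp [mat])
    (fun x y hx hy => by
      rw [D.lc_mul x y hx hy, D.ord_mul x y hx hy,
        mat_mul_eq_add (D.lc_ne_zero x hx) (D.lc_ne_zero y hy)])
    (fun x y hx hy hxy => by
      have h := D.lc_ne_zero _ hxy
      rcases D.add x y hx hy hxy with ⟨h1, h2⟩ | ⟨h1, h2⟩ | ⟨h1, h2, h3⟩ | ⟨h1, h2⟩
      · rw [h1, h2, sub_self, zero_mul]
      · rw [h1, h2, sub_self, mul_zero]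
      · rw [mat_sub (D.lc_ne_zero x hx) h, mat_sub (D.lc_ne_zero y hy) h, h1, h2, sub_self]
        refine mat_mul_mat_of_add_eq_one (div_ne_zero (D.lc_ne_zero x hx) h)
          (div_ne_zero (D.lc_ne_zero y hy) h) ?_
        rw [← add_div, h3, div_self h]
      · rw [mat_sub (D.lc_ne_zero x hx) h, mat_sub (D.lc_ne_zero y hy) h, h1,
          show D.lc y = - D.lc x by rw [h2, neg_neg], neg_div]
        exact mat_mul_mat_neg (div_ne_zero (D.lc_ne_zero x hx) h) _)

lemma resMat_sym (x : R) : D.resMat (sym x) = mat (D.lc x) (D.ord x) := by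
  simp [resMat]

lemma resMat_zero_one (z : MilnorRing R) : D.resMat z 0 1 = 0 := by
  have hz : z ∈ Subring.closure (Set.range (sym : R → MilnorRing R)) := by
    rw [closure_range_sym]; trivial
  induction hz using Subring.closure_induction with
  | mem x hx => obtain ⟨y, rfl⟩ := hx; simp [resMat_sym, mat]
  | zero => simp
  | one => simp
  | add x y _ _ hx hy => simp [hx, hy]
  | neg x _ hx => simp [hx]
  | mul x y _ _ hx hy => simp [Matrix.mul_apply, Fin.sum_univ_two, hx, hy]

/-- The specialization homomorphism. -/
noncomputable def spec : MilnorRing R →+* MilnorRing k where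
  toFun z := D.resMat z 0 0
  map_one' := by simp
  map_mul' x y := by simp [Matrix.mul_apply, Fin.sum_univ_two, resMat_zero_one]
  map_zero' := by simp
  map_add' x y := by simp

/-- The specialization homomorphism twisted by the grading involution. -/
noncomputable def spec' : MilnorRing R →+* MilnorRing k where
  toFun z := D.resMat z 1 1
  map_one' := by simp
  map_mul' x y := by simp [Matrix.mul_apply, Fin.sum_univ_two, resMat_zero_one]
  map_zero' := by simp
  map_add' x y := by simp

/-- The residue map. -/
noncomputable def res : MilnorRing R →+ MilnorRing k where
  toFun z := D.resMat z 1 0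
  map_zero' := by simp
  map_add' x y := by simp

lemma res_mul (x y : MilnorRing R) :
    D.res (x * y) = D.res x * D.spec y + D.spec' x * D.res y := by
  simp [res, spec, spec', Matrix.mul_apply, Fin.sum_univ_two]

@[simp] lemma spec_sym (x : R) : D.spec (sym x) = sym (D.lc x) := by
  simp [spec, resMat_sym, mat]

@[simp] lemma spec'_sym (x : R) :
    D.spec' (sym x) = D.ord x • sym (-1) - sym (D.lc x) := by
  simp [spec', resMat_sym, mat]

@[simp] lemma res_sym (x : R) : D.res (sym x) = D.ord x := by
  simp [res, resMat_sym, mat]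

/-- The subring of elements with vanishing residue. -/
def kerRes : Subring (MilnorRing R) where
  carrier := {z | D.res z = 0}
  mul_mem' {x y} hx hy := by
    simp only [Set.mem_ofPred_eq] at *
    rw [res_mul, hx, hy]; simp
  one_mem' := by simp [res]
  add_mem' {x y} hx hy := by
    simp only [Set.mem_ofPred_eq] at *
    rw [map_add, hx, hy]; simp
  zero_mem' := by simp
  neg_mem' {x} hx := by
    simp only [Set.mem_ofPred_eq] at *
    rw [map_neg, hx]; simp

lemma mem_kerRes {z : MilnorRing R} : z ∈ D.kerRes ↔ D.res z = 0 := Iff.rfl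

end TameDatum

/-! ### The places of a rational function field -/

/-- The finite places of the rational function field over `k`, i.e. the monic irreducible
polynomials. -/
abbrev FinitePlace (k : Type*) [Field k] := {v : Polynomial k // v.Monic ∧ Irreducible v}

namespace FinitePlace

open MilnorRing

variable {k : Type*} [Field k]

instance (v : FinitePlace k) : Fact (Irreducible v.1) := ⟨v.2.2⟩

/-- The residue field of a finite place. -/
abbrev ResidueField (v : FinitePlace k) := AdjoinRoot v.1

open Classical in
/-- The order of vanishing of a polynomial at a finite place, zero for the zero polynomial. -/
noncomputable def order (v : FinitePlace k) (f : Polynomial k) : ℤ :=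
  if f = 0 then 0 else multiplicity v.1 f

/-- The leading coefficient of a polynomial at a finite place. -/
noncomputable def leadingCoefficient (v : FinitePlace k) (f : Polynomial k) : v.ResidueField :=
  AdjoinRoot.mk v.1 (f / v.1 ^ multiplicity v.1 f)

lemma exists_eq_pow_mul (v : FinitePlace k) {f : Polynomial k} (hf : f ≠ 0) :
    ∃ (n : ℕ) (u : Polynomial k), f = v.1 ^ n * u ∧ ¬ v.1 ∣ u :=
  ⟨_, (FiniteMultiplicity.of_not_isUnit v.2.2.not_isUnit hf).exists_eq_pow_mul_and_not_dvd⟩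

lemma multiplicity_pow_mul (v : FinitePlace k) (n : ℕ) {u : Polynomial k} (hu : ¬ v.1 ∣ u) :
    multiplicity v.1 (v.1 ^ n * u) = n := by
  refine multiplicity_eq_of_dvd_of_not_dvd (dvd_mul_right _ _) ?_
  rw [pow_succ]
  intro h
  exact hu ((mul_dvd_mul_iff_left (pow_ne_zero n v.2.2.ne_zero)).mp h)

lemma order_pow_mul (v : FinitePlace k) (n : ℕ) {u : Polynomial k} (hu : ¬ v.1 ∣ u) :
    v.order (v.1 ^ n * u) = n := by
  have hu0 : u ≠ 0 := fun h => hu (h ▸ dvd_zero _)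
  rw [order, if_neg (mul_ne_zero (pow_ne_zero n v.2.2.ne_zero) hu0), multiplicity_pow_mul v n hu]

lemma leadingCoefficient_pow_mul (v : FinitePlace k) (n : ℕ) {u : Polynomial k} (hu : ¬ v.1 ∣ u) :
    v.leadingCoefficient (v.1 ^ n * u) = AdjoinRoot.mk v.1 u := by
  rw [leadingCoefficient, multiplicity_pow_mul v n hu,
    mul_div_cancel_left₀ _ (pow_ne_zero n v.2.2.ne_zero)]

lemma order_of_not_dvd (v : FinitePlace k) {u : Polynomial k} (hu : ¬ v.1 ∣ u) :
    v.order u = 0 := by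
  simpa using v.order_pow_mul 0 hu

lemma leadingCoefficient_of_not_dvd (v : FinitePlace k) {u : Polynomial k} (hu : ¬ v.1 ∣ u) :
    v.leadingCoefficient u = AdjoinRoot.mk v.1 u := by
  simpa using v.leadingCoefficient_pow_mul 0 hu

/-- The tame datum of a finite place. -/
noncomputable def tame (v : FinitePlace k) : TameDatum (Polynomial k) v.ResidueField where
  ord := v.order
  lc := v.leadingCoefficient
  ord_zero := by simp [order]
  lc_zero := by simp [leadingCoefficient]
  lc_ne_zero x hx := by
    obtain ⟨n, u, rfl, hu⟩ := v.exists_eq_pow_mul hx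
    rwa [v.leadingCoefficient_pow_mul n hu, Ne, AdjoinRoot.mk_eq_zero]
  ord_mul x y hx hy := by
    obtain ⟨n, u, rfl, hu⟩ := v.exists_eq_pow_mul hx
    obtain ⟨m, w, rfl, hw⟩ := v.exists_eq_pow_mul hy
    rw [show v.1 ^ n * u * (v.1 ^ m * w) = v.1 ^ (n + m) * (u * w) by ring,
      v.order_pow_mul _ hu, v.order_pow_mul _ hw, v.order_pow_mul _ (v.2.2.prime.not_dvd_mul hu hw)]
    simp
  lc_mul x y hx hy := by
    obtain ⟨n, u, rfl, hu⟩ := v.exists_eq_pow_mul hx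
    obtain ⟨m, w, rfl, hw⟩ := v.exists_eq_pow_mul hy
    rw [show v.1 ^ n * u * (v.1 ^ m * w) = v.1 ^ (n + m) * (u * w) by ring,
      v.leadingCoefficient_pow_mul _ hu, v.leadingCoefficient_pow_mul _ hw,
      v.leadingCoefficient_pow_mul _ (v.2.2.prime.not_dvd_mul hu hw), map_mul]
  add x y hx hy _ := by
    obtain ⟨n, u, rfl, hu⟩ := v.exists_eq_pow_mul hx
    obtain ⟨m, w, rfl, hw⟩ := v.exists_eq_pow_mul hy
    rw [v.order_pow_mul _ hu, v.order_pow_mul _ hw, v.leadingCoefficient_pow_mul _ hu,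
      v.leadingCoefficient_pow_mul _ hw]
    rcases lt_trichotomy n m with h | rfl | h
    · left
      obtain ⟨d, rfl⟩ := Nat.exists_eq_add_of_lt h
      have hd : v.1 ∣ v.1 ^ (d + 1) * w := (dvd_pow_self _ d.succ_ne_zero).mul_right w
      have h1 : ¬ v.1 ∣ u + v.1 ^ (d + 1) * w := fun h => hu ((dvd_add_left hd).mp h)
      rw [show v.1 ^ n * u + v.1 ^ (n + d + 1) * w = v.1 ^ n * (u + v.1 ^ (d + 1) * w) by ring,
        v.order_pow_mul _ h1, v.leadingCoefficient_pow_mul _ h1, map_add,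
        AdjoinRoot.mk_eq_zero.mpr hd, add_zero]
      exact ⟨rfl, rfl⟩
    · right; right
      by_cases h1 : v.1 ∣ u + w
      · right
        refine ⟨rfl, eq_neg_of_add_eq_zero_left ?_⟩
        rw [← map_add, AdjoinRoot.mk_eq_zero.mpr h1]
      · left
        rw [← mul_add, v.order_pow_mul _ h1, v.leadingCoefficient_pow_mul _ h1, map_add]
        exact ⟨rfl, rfl, rfl⟩
    · right; left
      obtain ⟨d, rfl⟩ := Nat.exists_eq_add_of_lt h
      have hd : v.1 ∣ v.1 ^ (d + 1) * u := (dvd_pow_self _ d.succ_ne_zero).mul_right u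
      have h1 : ¬ v.1 ∣ v.1 ^ (d + 1) * u + w := fun h => hw ((dvd_add_right hd).mp h)
      rw [show v.1 ^ (m + d + 1) * u + v.1 ^ m * w = v.1 ^ m * (v.1 ^ (d + 1) * u + w) by ring,
        v.order_pow_mul _ h1, v.leadingCoefficient_pow_mul _ h1, map_add,
        AdjoinRoot.mk_eq_zero.mpr hd, zero_add]
      exact ⟨rfl, rfl⟩

@[simp] lemma tame_ord (v : FinitePlace k) (f : Polynomial k) : v.tame.ord f = v.order f := rfl

@[simp] lemma tame_lc (v : FinitePlace k) (f : Polynomial k) :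
    v.tame.lc f = v.leadingCoefficient f := rfl

end FinitePlace

/-- The tame datum of the place at infinity of the rational function field. -/
noncomputable def tameInfinity (k : Type*) [Field k] : TameDatum (Polynomial k) k where
  ord f := -(f.natDegree : ℤ)
  lc f := f.leadingCoeff
  ord_zero := by simp
  lc_zero := by simp
  lc_ne_zero x hx := Polynomial.leadingCoeff_ne_zero.mpr hx
  ord_mul x y hx hy := by rw [Polynomial.natDegree_mul hx hy]; push_cast; ring
  lc_mul x y _ _ := Polynomial.leadingCoeff_mul x y
  add x y hx hy hxy := by
    rcases lt_trichotomy x.degree y.degree with h | h | h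
    · right; left
      rw [Polynomial.leadingCoeff_add_of_degree_lt h,
        Polynomial.natDegree_eq_of_degree_eq (Polynomial.degree_add_eq_right_of_degree_lt h)]
      exact ⟨rfl, rfl⟩
    · right; right
      have h' := Polynomial.natDegree_eq_of_degree_eq h
      by_cases h1 : x.leadingCoeff + y.leadingCoeff = 0
      · right
        exact ⟨by rw [h'], eq_neg_of_add_eq_zero_left h1⟩
      · left
        have h2 := Polynomial.degree_add_eq_of_leadingCoeff_add_ne_zero h1
        rw [h, max_self] at h2
        rw [Polynomial.leadingCoeff_add_of_degree_eq h h1, Polynomial.natDegree_eq_of_degree_eq h2,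
          h']
        exact ⟨rfl, rfl, rfl⟩
    · left
      rw [Polynomial.leadingCoeff_add_of_degree_lt' h,
        Polynomial.natDegree_eq_of_degree_eq (Polynomial.degree_add_eq_left_of_degree_lt h)]
      exact ⟨rfl, rfl⟩

/-! ### The degree filtration -/

section Filtration

open MilnorRing

variable {k : Type*} [Field k]

/-- The subring generated by the symbols of polynomials of degree less than `d`. -/
noncomputable def degreeLT (k : Type*) [Field k] (d : ℕ) : Subring (MilnorRing (Polynomial k)) :=
  Subring.closure {z | ∃ f : Polynomial k, f.natDegree < d ∧ z = sym f}

lemma sym_mem_degreeLT {d : ℕ} {f : Polynomial k} (hf : f.natDegree < d) :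
    sym f ∈ degreeLT k d :=
  Subring.subset_closure ⟨f, hf, rfl⟩

lemma degreeLT_mono {d e : ℕ} (h : d ≤ e) : degreeLT k d ≤ degreeLT k e := by
  refine Subring.closure_mono ?_
  rintro _ ⟨f, hf, rfl⟩
  exact ⟨f, hf.trans_le h, rfl⟩

lemma exists_mem_degreeLT (z : MilnorRing (Polynomial k)) : ∃ d, z ∈ degreeLT k d := by
  have hz : z ∈ Subring.closure (Set.range (sym : Polynomial k → _)) := by
    rw [closure_range_sym]; trivial
  induction hz using Subring.closure_induction with
  | mem x hx => obtain ⟨f, rfl⟩ := hx; exact ⟨_, sym_mem_degreeLT f.natDegree.lt_succ_self⟩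
  | zero => exact ⟨0, zero_mem _⟩
  | one => exact ⟨0, one_mem _⟩
  | neg x _ hx => obtain ⟨d, hd⟩ := hx; exact ⟨d, neg_mem hd⟩
  | add x y _ _ hx hy =>
    obtain ⟨d, hd⟩ := hx
    obtain ⟨e, he⟩ := hy
    exact ⟨max d e, add_mem (degreeLT_mono (le_max_left _ _) hd)
      (degreeLT_mono (le_max_right _ _) he)⟩
  | mul x y _ _ hx hy =>
    obtain ⟨d, hd⟩ := hx
    obtain ⟨e, he⟩ := hy
    exact ⟨max d e, mul_mem (degreeLT_mono (le_max_left _ _) hd)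
      (degreeLT_mono (le_max_right _ _) he)⟩

lemma exists_sym_mul_eq_mul_sym {d : ℕ} {g : Polynomial k} (hg : g ≠ 0)
    {z : MilnorRing (Polynomial k)} (hz : z ∈ degreeLT k d) :
    ∃ z' ∈ degreeLT k d, sym g * z = z' * sym g := by
  induction hz using Subring.closure_induction with
  | mem x hx =>
    obtain ⟨f, hf, rfl⟩ := hx
    by_cases h : f = 0
    · exact ⟨0, zero_mem _, by simp [h]⟩
    · exact ⟨-sym f, neg_mem (sym_mem_degreeLT hf), by rw [sym_mul_comm hg h, neg_mul]⟩
  | zero => exact ⟨0, zero_mem _, by simp⟩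
  | one => exact ⟨1, one_mem _, by simp⟩
  | neg x _ hx =>
    obtain ⟨x', hx', h⟩ := hx
    exact ⟨-x', neg_mem hx', by rw [mul_neg, h, neg_mul]⟩
  | add x y _ _ hx hy =>
    obtain ⟨x', hx', h⟩ := hx
    obtain ⟨y', hy', h'⟩ := hy
    exact ⟨x' + y', add_mem hx' hy', by rw [mul_add, h, h', add_mul]⟩
  | mul x y _ _ hx hy =>
    obtain ⟨x', hx', h⟩ := hx
    obtain ⟨y', hy', h'⟩ := hy
    exact ⟨x' * y', mul_mem hx' hy', by rw [← mul_assoc, h, mul_assoc, h', mul_assoc]⟩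

namespace FinitePlace

/-- The degree of a finite place. -/
noncomputable def deg (v : FinitePlace k) : ℕ := v.1.natDegree

lemma deg_pos (v : FinitePlace k) : 0 < v.deg := v.2.2.natDegree_pos

lemma not_dvd_of_natDegree_lt (v : FinitePlace k) {f : Polynomial k} (hf : f ≠ 0)
    (h : f.natDegree < v.deg) : ¬ v.1 ∣ f :=
  fun hd => absurd (Polynomial.natDegree_le_of_dvd hd hf) (not_le.mpr h)

lemma not_dvd_of_ne {v w : FinitePlace k} (h : v ≠ w) : ¬ v.1 ∣ w.1 := fun hd =>
  h (Subtype.ext (Polynomial.eq_of_monic_of_associated v.2.1 w.2.1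
    (v.2.2.associated_of_dvd w.2.2 hd)))

lemma order_self (v : FinitePlace k) : v.order v.1 = 1 := by
  have : ¬ v.1 ∣ 1 := fun h => v.2.2.not_isUnit (isUnit_of_dvd_one h)
  simpa using v.order_pow_mul 1 this

lemma sym_mem_kerRes (v : FinitePlace k) {f : Polynomial k} (h : ¬ v.1 ∣ f) :
    sym f ∈ v.tame.kerRes := by
  rw [TameDatum.mem_kerRes, TameDatum.res_sym, tame_ord, v.order_of_not_dvd h, Int.cast_zero]

lemma degreeLT_le_kerRes (v : FinitePlace k) {d : ℕ} (hd : d ≤ v.deg) :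
    degreeLT k d ≤ v.tame.kerRes := by
  rw [degreeLT, Subring.closure_le]
  rintro _ ⟨f, hf, rfl⟩
  by_cases h : f = 0
  · simp [h, zero_mem]
  · exact v.sym_mem_kerRes (v.not_dvd_of_natDegree_lt h (hf.trans_le hd))

lemma res_sym_self_mul (v : FinitePlace k) {z : MilnorRing (Polynomial k)}
    (hz : z ∈ v.tame.kerRes) : v.tame.res (sym v.1 * z) = v.tame.spec z := by
  rw [TameDatum.res_mul, v.tame.mem_kerRes.mp hz, TameDatum.res_sym, tame_ord, order_self]
  simp

/-- The canonical representative of a residue class. -/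
noncomputable def rep (v : FinitePlace k) : v.ResidueField →+ Polynomial k :=
  (AdjoinRoot.modByMonicHom v.2.1).toAddMonoidHom

lemma rep_mk (v : FinitePlace k) (f : Polynomial k) : v.rep (AdjoinRoot.mk v.1 f) = f %ₘ v.1 :=
  AdjoinRoot.modByMonicHom_mk v.2.1 f

lemma mk_rep (v : FinitePlace k) (x : v.ResidueField) : AdjoinRoot.mk v.1 (v.rep x) = x :=
  AdjoinRoot.mk_leftInverse v.2.1 x

lemma natDegree_rep_lt (v : FinitePlace k) (x : v.ResidueField) :
    (v.rep x).natDegree < v.deg := by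
  rw [← v.mk_rep x, rep_mk]
  exact Polynomial.natDegree_modByMonic_lt _ v.2.1 (fun h => v.2.2.not_isUnit (h ▸ isUnit_one))

lemma rep_ne_zero (v : FinitePlace k) {x : v.ResidueField} (hx : x ≠ 0) : v.rep x ≠ 0 := by
  intro h
  apply hx
  rw [← v.mk_rep x, h, map_zero]

/-- The ideal of those elements of lower degree whose product with the symbol of the place has
lower degree. -/
def lowerIdeal (v : FinitePlace k) : Ideal (degreeLT k v.deg) where
  carrier := {z | sym v.1 * (z : MilnorRing (Polynomial k)) ∈ degreeLT k v.deg}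
  add_mem' {x y} hx hy := by
    simp only [Set.mem_ofPred_eq, Subring.coe_add, mul_add] at *
    exact add_mem hx hy
  zero_mem' := by simp [zero_mem]
  smul_mem' a x hx := by
    simp only [Set.mem_ofPred_eq, smul_eq_mul, Subring.coe_mul] at *
    obtain ⟨a', ha', h⟩ := exists_sym_mul_eq_mul_sym v.2.2.ne_zero a.2
    rw [← mul_assoc, h, mul_assoc]
    exact mul_mem ha' hx

lemma mem_lowerIdeal (v : FinitePlace k) {z : degreeLT k v.deg} :
    z ∈ v.lowerIdeal ↔ sym v.1 * (z : MilnorRing (Polynomial k)) ∈ degreeLT k v.deg := Iff.rfl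

instance (v : FinitePlace k) : v.lowerIdeal.IsTwoSided where
  mul_mem_of_left {a} b ha := by
    rw [mem_lowerIdeal] at *
    rw [Subring.coe_mul, ← mul_assoc]
    exact mul_mem ha b.2

lemma sym_rep_mul_sub_mem (v : FinitePlace k) {x y : v.ResidueField} (hx : x ≠ 0) (hy : y ≠ 0) :
    sym v.1 * (sym (v.rep (x * y)) - (sym (v.rep x) + sym (v.rep y))) ∈ degreeLT k v.deg := by
  have hgx := v.rep_ne_zero hx
  have hgy := v.rep_ne_zero hy
  have hr := v.rep_ne_zero (mul_ne_zero hx hy)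
  have mr := sym_mem_degreeLT (v.natDegree_rep_lt (x * y))
  have mx := sym_mem_degreeLT (v.natDegree_rep_lt x)
  have my := sym_mem_degreeLT (v.natDegree_rep_lt y)
  have hdiv : v.rep (x * y) + v.1 * ((v.rep x * v.rep y) /ₘ v.1) = v.rep x * v.rep y := by
    have : v.rep (x * y) = (v.rep x * v.rep y) %ₘ v.1 := by
      rw [← v.rep_mk, map_mul (AdjoinRoot.mk v.1), v.mk_rep, v.mk_rep]
    rw [this]
    exact Polynomial.modByMonic_add_div _ v.1
  rw [← sym_mul hgx hgy]
  set q := (v.rep x * v.rep y) /ₘ v.1 with hq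
  by_cases hq0 : q = 0
  · rw [hq0, mul_zero, add_zero] at hdiv
    rw [hdiv, sub_self, mul_zero]
    exact zero_mem _
  have hqd : q.natDegree < v.deg := by
    rw [hq, Polynomial.natDegree_divByMonic _ v.2.1, Polynomial.natDegree_mul hgx hgy]
    have h1 := v.natDegree_rep_lt x
    have h2 := v.natDegree_rep_lt y
    unfold deg at *
    omega
  have hst := sym_steinberg hr (mul_ne_zero v.2.2.ne_zero hq0)
    (by rw [hdiv]; exact mul_ne_zero hgx hgy)
  rw [hdiv, sym_mul v.2.2.ne_zero hq0, add_sub_assoc, mul_add] at hst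
  have hcomm : sym v.1 * (sym (v.rep (x * y)) - sym (v.rep x * v.rep y)) =
      - ((sym (v.rep (x * y)) - sym (v.rep x * v.rep y)) * sym v.1) := by
    rw [mul_sub, sub_mul, sym_mul_comm v.2.2.ne_zero hr,
      sym_mul_comm v.2.2.ne_zero (mul_ne_zero hgx hgy)]
    abel
  rw [hcomm, eq_neg_of_add_eq_zero_left hst, neg_neg]
  have mxy : sym (v.rep x * v.rep y) ∈ degreeLT k v.deg := by
    rw [sym_mul hgx hgy]; exact add_mem mx my
  exact mul_mem (sub_mem mr mxy) (sub_mem (sym_mem_degreeLT hqd) mxy)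

/-- The homomorphism from the Milnor ring of the residue field of a place to the ring of symbols
of lower degree modulo the annihilator of the place. -/
noncomputable def toLowerQuotient (v : FinitePlace k) :
    MilnorRing v.ResidueField →+* degreeLT k v.deg ⧸ v.lowerIdeal :=
  lift (fun x => Ideal.Quotient.mk v.lowerIdeal
      ⟨sym (v.rep x), sym_mem_degreeLT (v.natDegree_rep_lt x)⟩)
    (by
      rw [Ideal.Quotient.eq_zero_iff_mem, mem_lowerIdeal]
      simp [zero_mem])
    (fun x y hx hy => by
      rw [← map_add, Ideal.Quotient.eq, mem_lowerIdeal]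
      exact v.sym_rep_mul_sub_mem hx hy)
    (fun x y hx hy hxy => by
      rw [← map_sub, ← map_sub, ← map_mul, Ideal.Quotient.eq_zero_iff_mem, mem_lowerIdeal]
      have := sym_steinberg (v.rep_ne_zero hx) (v.rep_ne_zero hy)
        (by rw [← map_add]; exact v.rep_ne_zero hxy)
      simp [this, zero_mem])

lemma toLowerQuotient_spec (v : FinitePlace k) (z : degreeLT k v.deg) :
    v.toLowerQuotient (v.tame.spec z) = Ideal.Quotient.mk v.lowerIdeal z := by
  obtain ⟨z, hz⟩ := z
  dsimp only
  induction hz using Subring.closure_induction with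
  | mem x hx =>
    obtain ⟨f, hf, rfl⟩ := hx
    rw [TameDatum.spec_sym, toLowerQuotient, lift_sym]
    congr 2
    by_cases h : f = 0
    · simp [h, leadingCoefficient]
    · rw [tame_lc, v.leadingCoefficient_of_not_dvd (v.not_dvd_of_natDegree_lt h hf), rep_mk,
        (Polynomial.modByMonic_eq_self_iff v.2.1).mpr (Polynomial.degree_lt_degree hf)]
  | zero => rw [map_zero, map_zero]; exact (map_zero _).symm
  | one => rw [map_one, map_one]; exact (map_one _).symm
  | neg x h hx =>
    rw [map_neg, map_neg, hx, ← map_neg]; rfl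
  | add x y h h' hx hy =>
    rw [map_add, map_add, hx, hy, ← map_add]; rfl
  | mul x y h h' hx hy =>
    rw [map_mul, map_mul, hx, hy, ← map_mul]; rfl

lemma sym_mul_mem_of_spec_eq_zero (v : FinitePlace k) {z : MilnorRing (Polynomial k)}
    (hz : z ∈ degreeLT k v.deg) (h : v.tame.spec z = 0) : sym v.1 * z ∈ degreeLT k v.deg := by
  have := v.toLowerQuotient_spec ⟨z, hz⟩
  rw [h, map_zero, eq_comm, Ideal.Quotient.eq_zero_iff_mem] at this
  exact this

lemma spec_surjective (v : FinitePlace k) (x : MilnorRing v.ResidueField) :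
    ∃ z ∈ degreeLT k v.deg, v.tame.spec z = x := by
  have hx : x ∈ Subring.closure (Set.range (sym : v.ResidueField → _)) := by
    rw [closure_range_sym]; trivial
  induction hx using Subring.closure_induction with
  | mem x hx =>
    obtain ⟨y, rfl⟩ := hx
    refine ⟨sym (v.rep y), sym_mem_degreeLT (v.natDegree_rep_lt y), ?_⟩
    by_cases h : y = 0
    · simp [h]
    · rw [TameDatum.spec_sym, tame_lc, v.leadingCoefficient_of_not_dvd
        (v.not_dvd_of_natDegree_lt (v.rep_ne_zero h) (v.natDegree_rep_lt y)), mk_rep]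
  | zero => exact ⟨0, zero_mem _, map_zero _⟩
  | one => exact ⟨1, one_mem _, map_one _⟩
  | neg x _ hx =>
    obtain ⟨z, hz, rfl⟩ := hx
    exact ⟨-z, neg_mem hz, map_neg _ _⟩
  | add x y _ _ hx hy =>
    obtain ⟨z, hz, rfl⟩ := hx
    obtain ⟨z', hz', rfl⟩ := hy
    exact ⟨z + z', add_mem hz hz', map_add _ _ _⟩
  | mul x y _ _ hx hy =>
    obtain ⟨z, hz, rfl⟩ := hx
    obtain ⟨z', hz', rfl⟩ := hy
    exact ⟨z * z', mul_mem hz hz', map_mul _ _ _⟩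

end FinitePlace

end Filtration

/-! ### Exactness and the transfer -/

section Transfer

open MilnorRing

variable {k : Type*} [Field k]

/-- The additive group generated by the symbols of degree less than `d` and their products with
the symbols of the places of degree `d`. -/
noncomputable def placeSpan (k : Type*) [Field k] (d : ℕ) :
    AddSubgroup (MilnorRing (Polynomial k)) :=
  AddSubgroup.closure ({z | z ∈ degreeLT k d} ∪
    {z | ∃ v : FinitePlace k, v.deg = d ∧ ∃ a ∈ degreeLT k d, z = sym v.1 * a})

lemma mem_placeSpan {d : ℕ} {z : MilnorRing (Polynomial k)} (hz : z ∈ degreeLT k d) :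
    z ∈ placeSpan k d :=
  AddSubgroup.subset_closure (Or.inl hz)

lemma sym_mul_mem_placeSpan (v : FinitePlace k) {z : MilnorRing (Polynomial k)}
    (hz : z ∈ degreeLT k v.deg) : sym v.1 * z ∈ placeSpan k v.deg :=
  AddSubgroup.subset_closure (Or.inr ⟨v, rfl, z, hz, rfl⟩)

lemma exists_sym_eq_add {d : ℕ} {f : Polynomial k} (hd : 0 < d) (hf : f.natDegree < d + 1) :
    (∃ a b : Polynomial k, a.natDegree < d ∧ b.natDegree < d ∧ sym f = sym a + sym b) ∨
      ∃ (c : k) (v : FinitePlace k), c ≠ 0 ∧ v.deg = d ∧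
        sym f = sym (Polynomial.C c) + sym v.1 := by
  rcases Nat.lt_succ_iff_lt_or_eq.mp hf with h | h
  · exact Or.inl ⟨f, 1, h, by simpa using hd, by simp⟩
  have hf0 : f ≠ 0 := by rintro rfl; simp at h; omega
  have hlc : f.leadingCoeff ≠ 0 := Polynomial.leadingCoeff_ne_zero.mpr hf0
  set g := f * Polynomial.C f.leadingCoeff⁻¹ with hg
  have hgm : g.Monic := Polynomial.monic_mul_leadingCoeff_inv hf0
  have hfg : f = Polynomial.C f.leadingCoeff * g := by
    rw [hg, mul_left_comm, ← Polynomial.C_mul, mul_inv_cancel₀ hlc, Polynomial.C_1, mul_one]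
  have hgd : g.natDegree = d := by
    rw [hfg, Polynomial.natDegree_C_mul hlc] at h; exact h
  have hsym : sym f = sym (Polynomial.C f.leadingCoeff) + sym g := by
    conv_lhs => rw [hfg]
    exact sym_mul (Polynomial.C_ne_zero.mpr hlc) hgm.ne_zero
  by_cases hirr : Irreducible g
  · exact Or.inr ⟨_, ⟨g, hgm, hirr⟩, hlc, hgd, hsym⟩
  left
  rw [hgm.irreducible_iff_natDegree, not_and] at hirr
  have hg1 : g ≠ 1 := by
    intro h1
    rw [h1, Polynomial.natDegree_one] at hgd
    omega
  specialize hirr hg1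
  push Not at hirr
  obtain ⟨a, b, ha, hb, hab, ha0, hb0⟩ := hirr
  have := ha.natDegree_mul hb
  rw [hab] at this
  refine ⟨Polynomial.C f.leadingCoeff * a, b, ?_, by omega, ?_⟩
  · rw [Polynomial.natDegree_C_mul hlc]
    omega
  · rw [hsym, ← hab, sym_mul ha.ne_zero hb.ne_zero,
      sym_mul (Polynomial.C_ne_zero.mpr hlc) ha.ne_zero, add_assoc]

lemma sym_mul_sym_eq (v w : FinitePlace k) (h : v.deg = w.deg) :
    ∃ a ∈ degreeLT k v.deg, ∃ b ∈ degreeLT k v.deg,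
      sym v.1 * sym w.1 = sym v.1 * a + sym w.1 * b := by
  have hm1 : sym (-1 : Polynomial k) ∈ degreeLT k v.deg :=
    sym_mem_degreeLT (by simpa using v.deg_pos)
  by_cases hvw : v = w
  · subst hvw
    exact ⟨_, hm1, 0, zero_mem _, by rw [mul_zero, add_zero, sym_mul_self v.2.2.ne_zero]⟩
  set r := v.1 - w.1 with hr
  have hr0 : r ≠ 0 := fun h => hvw (Subtype.ext (sub_eq_zero.mp h))
  have hrd : r.natDegree < v.deg := by
    refine Polynomial.natDegree_lt_natDegree hr0 (Polynomial.degree_sub_lt_left ?_ v.2.2.ne_zero ?_)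
    · rw [Polynomial.degree_eq_natDegree v.2.2.ne_zero,
        Polynomial.degree_eq_natDegree w.2.2.ne_zero]
      exact congrArg _ h
    · rw [v.2.1.leadingCoeff, w.2.1.leadingCoeff]
  have hst := sym_steinberg hr0 w.2.2.ne_zero (by rw [hr, sub_add_cancel]; exact v.2.2.ne_zero)
  rw [hr, sub_add_cancel, ← hr, sub_mul, mul_sub, mul_sub, sym_mul_comm hr0 w.2.2.ne_zero,
    sym_mul_comm hr0 v.2.2.ne_zero, sym_mul_self v.2.2.ne_zero] at hst
  refine ⟨sym (-1) + sym r, add_mem hm1 (sym_mem_degreeLT hrd), -sym r,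
    neg_mem (sym_mem_degreeLT hrd), ?_⟩
  rw [mul_add, mul_neg, ← sub_eq_zero, ← neg_eq_zero, ← hst]
  abel

lemma sym_mul_mem_placeSpan_of_lt {d : ℕ} {f : Polynomial k} (hf : f.natDegree < d)
    {z : MilnorRing (Polynomial k)} (hz : z ∈ placeSpan k d) : sym f * z ∈ placeSpan k d := by
  by_cases hf0 : f = 0
  · simp [hf0, zero_mem]
  induction hz using AddSubgroup.closure_induction with
  | mem x hx =>
    rcases hx with hx | ⟨v, rfl, a, ha, rfl⟩
    · exact mem_placeSpan (mul_mem (sym_mem_degreeLT hf) hx)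
    · rw [← mul_assoc, sym_mul_comm hf0 v.2.2.ne_zero, neg_mul, mul_assoc]
      exact neg_mem (sym_mul_mem_placeSpan v (mul_mem (sym_mem_degreeLT hf) ha))
  | zero => simp [zero_mem]
  | add x y _ _ hx hy => rw [mul_add]; exact add_mem hx hy
  | neg x _ hx => rw [mul_neg]; exact neg_mem hx

lemma sym_place_mul_mem_placeSpan (v : FinitePlace k)
    {z : MilnorRing (Polynomial k)} (hz : z ∈ placeSpan k v.deg) :
    sym v.1 * z ∈ placeSpan k v.deg := by
  induction hz using AddSubgroup.closure_induction with
  | mem x hx =>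
    rcases hx with hx | ⟨w, hw, a, ha, rfl⟩
    · exact sym_mul_mem_placeSpan v hx
    · obtain ⟨b, hb, c, hc, h⟩ := sym_mul_sym_eq v w hw.symm
      rw [← mul_assoc, h, add_mul, mul_assoc, mul_assoc]
      refine add_mem (sym_mul_mem_placeSpan v (mul_mem hb ha)) ?_
      rw [← hw] at ha hc ⊢
      exact sym_mul_mem_placeSpan w (mul_mem hc ha)
  | zero => simp [zero_mem]
  | add x y _ _ hx hy => rw [mul_add]; exact add_mem hx hy
  | neg x _ hx => rw [mul_neg]; exact neg_mem hx

lemma degreeLT_succ_le_placeSpan {d : ℕ} (hd : 0 < d) {z : MilnorRing (Polynomial k)}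
    (hz : z ∈ degreeLT k (d + 1)) : z ∈ placeSpan k d := by
  suffices h : ∀ y ∈ placeSpan k d, z * y ∈ placeSpan k d by
    simpa using h 1 (mem_placeSpan (one_mem _))
  induction hz using Subring.closure_induction with
  | mem x hx =>
    obtain ⟨f, hf, rfl⟩ := hx
    intro y hy
    rcases exists_sym_eq_add hd hf with ⟨a, b, ha, hb, h⟩ | ⟨c, v, hc, rfl, h⟩
    · rw [h, add_mul]
      exact add_mem (sym_mul_mem_placeSpan_of_lt ha hy) (sym_mul_mem_placeSpan_of_lt hb hy)
    · rw [h, add_mul]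
      exact add_mem (sym_mul_mem_placeSpan_of_lt (by simpa using hd) hy)
        (sym_place_mul_mem_placeSpan v hy)
  | zero => intro y _; simp [zero_mem]
  | one => intro y hy; simpa using hy
  | neg x _ hx => intro y hy; rw [neg_mul]; exact neg_mem (hx y hy)
  | add x y _ _ hx hy => intro z hz; rw [add_mul]; exact add_mem (hx z hz) (hy z hz)
  | mul x y _ _ hx hy => intro z hz; rw [mul_assoc]; exact hx _ (hy z hz)

lemma exists_finsupp_of_mem_placeSpan {d : ℕ} {z : MilnorRing (Polynomial k)}
    (hz : z ∈ placeSpan k d) :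
    ∃ c : FinitePlace k →₀ degreeLT k d, (∀ v, v.deg ≠ d → c v = 0) ∧
      z - c.sum (fun v a => sym v.1 * (a : MilnorRing (Polynomial k))) ∈ degreeLT k d := by
  induction hz using AddSubgroup.closure_induction with
  | mem x hx =>
    rcases hx with hx | ⟨v, hv, a, ha, rfl⟩
    · exact ⟨0, fun _ _ => rfl, by simpa using hx⟩
    · refine ⟨Finsupp.single v ⟨a, ha⟩, fun w hw => ?_, ?_⟩
      · exact Finsupp.single_eq_of_ne (by rintro rfl; exact hw hv)
      · rw [Finsupp.sum_single_index (by simp), sub_self]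
        exact zero_mem _
  | zero => exact ⟨0, fun _ _ => rfl, by simp [zero_mem]⟩
  | add x y _ _ hx hy =>
    obtain ⟨c, hc, h⟩ := hx
    obtain ⟨c', hc', h'⟩ := hy
    refine ⟨c + c', fun v hv => by rw [Finsupp.add_apply, hc v hv, hc' v hv, add_zero], ?_⟩
    rw [Finsupp.sum_add_index' (by simp) (by simp [mul_add]), add_sub_add_comm]
    exact add_mem h h'
  | neg x _ hx =>
    obtain ⟨c, hc, h⟩ := hx
    refine ⟨-c, fun v hv => by rw [Finsupp.neg_apply, hc v hv, neg_zero], ?_⟩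
    rw [Finsupp.sum_neg_index (by simp)]
    simp only [Subring.coe_neg, mul_neg, Finsupp.sum, Finset.sum_neg_distrib] at h ⊢
    rw [sub_neg_eq_add, neg_add_eq_sub, ← neg_sub]
    exact neg_mem h

lemma mem_degreeLT_of_res_eq_zero {d : ℕ} (hd : 0 < d) {z : MilnorRing (Polynomial k)}
    (hz : z ∈ degreeLT k (d + 1)) (h : ∀ v : FinitePlace k, v.tame.res z = 0) :
    z ∈ degreeLT k d := by
  obtain ⟨c, hc, hcz⟩ := exists_finsupp_of_mem_placeSpan (degreeLT_succ_le_placeSpan hd hz)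
  suffices hs : ∀ v, sym v.1 * (c v : MilnorRing (Polynomial k)) ∈ degreeLT k d by
    have := add_mem hcz (sum_mem (t := c.support) fun v _ => hs v)
    rwa [Finsupp.sum, sub_add_cancel] at this
  intro w
  by_cases hw : w.deg = d
  swap
  · simp [hc w hw, zero_mem]
  subst hw
  have hcw : ∀ v : FinitePlace k,
      ((c v : degreeLT k w.deg) : MilnorRing (Polynomial k)) ∈ w.tame.kerRes :=
    fun v => w.degreeLT_le_kerRes le_rfl (c v).2
  have h1 := w.degreeLT_le_kerRes le_rfl hcz
  rw [TameDatum.mem_kerRes, map_sub, h w, zero_sub, neg_eq_zero, Finsupp.sum, map_sum,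
    Finset.sum_eq_single w, w.res_sym_self_mul (hcw w)] at h1
  · exact w.sym_mul_mem_of_spec_eq_zero (c w).2 h1
  · intro v _ hv
    exact mul_mem (w.sym_mem_kerRes (FinitePlace.not_dvd_of_ne hv.symm)) (hcw v)
  · intro hw
    simp [Finsupp.notMem_support_iff.mp hw]

lemma degreeLT_one_le_kerRes : degreeLT k 1 ≤ (tameInfinity k).kerRes := by
  rw [degreeLT, Subring.closure_le]
  rintro _ ⟨f, hf, rfl⟩
  rw [SetLike.mem_coe, TameDatum.mem_kerRes, TameDatum.res_sym]
  simp [tameInfinity, Nat.lt_one_iff.mp hf]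

theorem res_infinity_eq_zero {z : MilnorRing (Polynomial k)}
    (h : ∀ v : FinitePlace k, v.tame.res z = 0) : (tameInfinity k).res z = 0 := by
  obtain ⟨d, hd⟩ := exists_mem_degreeLT z
  suffices z ∈ degreeLT k 1 from degreeLT_one_le_kerRes this
  induction d with
  | zero => exact degreeLT_mono zero_le_one hd
  | succ d ih =>
    rcases Nat.eq_zero_or_pos d with rfl | h0
    · exact hd
    · exact ih (mem_degreeLT_of_res_eq_zero h0 hd h)

lemma finite_setOf_dvd {f : Polynomial k} (hf : f ≠ 0) :
    {v : FinitePlace k | v.1 ∣ f}.Finite := by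
  classical
  refine Set.Finite.of_finite_image (f := Subtype.val) ?_ Subtype.val_injective.injOn
  refine (UniqueFactorizationMonoid.normalizedFactors f).toFinset.finite_toSet.subset ?_
  rintro _ ⟨v, hv, rfl⟩
  rw [Finset.mem_coe, Multiset.mem_toFinset,
    Polynomial.mem_normalizedFactors_iff hf]
  exact ⟨v.2.2, v.2.1, hv⟩

lemma finite_setOf_res_ne_zero (z : MilnorRing (Polynomial k)) :
    {v : FinitePlace k | v.tame.res z ≠ 0}.Finite := by
  suffices h : {v : FinitePlace k | z ∉ v.tame.kerRes}.Finite from h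
  have hz : z ∈ Subring.closure (Set.range (sym : Polynomial k → _)) := by
    rw [closure_range_sym]; trivial
  induction hz using Subring.closure_induction with
  | mem x hx =>
    obtain ⟨f, rfl⟩ := hx
    by_cases hf : f = 0
    · simp [hf, zero_mem]
    · exact (finite_setOf_dvd hf).subset fun v hv => by
        by_contra h
        exact hv (v.sym_mem_kerRes h)
  | zero => simp [zero_mem]
  | one => simp [one_mem]
  | neg x _ hx => simpa using hx
  | add x y _ _ hx hy =>
    refine (hx.union hy).subset fun v hv => ?_
    by_contra h
    simp only [Set.mem_union, Set.mem_ofPred_eq, not_or, not_not] at h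
    exact hv (add_mem h.1 h.2)
  | mul x y _ _ hx hy =>
    refine (hx.union hy).subset fun v hv => ?_
    by_contra h
    simp only [Set.mem_union, Set.mem_ofPred_eq, not_or, not_not] at h
    exact hv (mul_mem h.1 h.2)

theorem exists_res_eq (v : FinitePlace k) (x : MilnorRing v.ResidueField) :
    ∃ z, v.tame.res z = x ∧ ∀ w : FinitePlace k, w ≠ v → w.tame.res z = 0 := by
  induction hd : v.deg using Nat.strong_induction_on generalizing v with
  | _ d ih =>
    subst hd
    obtain ⟨a, ha, rfl⟩ := v.spec_surjective x
    set z := sym v.1 * a with hz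
    have hzv : v.tame.res z = v.tame.spec a := v.res_sym_self_mul (v.degreeLT_le_kerRes le_rfl ha)
    have hzw : ∀ w : FinitePlace k, w ≠ v → v.deg ≤ w.deg → w.tame.res z = 0 := fun w hw hwv =>
      mul_mem (w.sym_mem_kerRes (FinitePlace.not_dvd_of_ne hw)) (w.degreeLT_le_kerRes hwv ha)
    have hlow : ∀ w : FinitePlace k, ∃ y, w.deg < v.deg → w.tame.res y = w.tame.res z ∧
        ∀ u : FinitePlace k, u ≠ w → u.tame.res y = 0 := fun w => by
      by_cases h : w.deg < v.deg
      · obtain ⟨y, hy⟩ := ih _ h w (w.tame.res z) rfl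
        exact ⟨y, fun _ => hy⟩
      · exact ⟨0, fun h' => absurd h' h⟩
    choose y hy using hlow
    classical
    let s := (finite_setOf_res_ne_zero z).toFinset.filter (fun w => w.deg < v.deg)
    have hs : ∀ w ∈ s, w.deg < v.deg := fun w hw => (Finset.mem_filter.mp hw).2
    refine ⟨z - ∑ w ∈ s, y w, ?_, fun w hw => ?_⟩
    · rw [map_sub, map_sum, hzv, Finset.sum_eq_zero, sub_zero]
      intro w hw
      refine (hy w (hs w hw)).2 v ?_
      rintro rfl
      exact lt_irrefl _ (hs _ hw)
    · rw [map_sub, map_sum]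
      by_cases hws : w ∈ s
      · rw [Finset.sum_eq_single_of_mem w hws fun u hu huw => (hy u (hs u hu)).2 w huw.symm,
          (hy w (hs w hws)).1, sub_self]
      · rw [Finset.sum_eq_zero fun u hu => (hy u (hs u hu)).2 w (by rintro rfl; exact hws hu),
          sub_zero]
        by_contra h
        rcases le_or_gt v.deg w.deg with hle | hlt
        · exact h (hzw w hw hle)
        · exact hws (by simp [s, h, hlt])

namespace FinitePlace

/-- The transfer from the Milnor ring of the residue field of a finite place. -/
noncomputable def transfer (v : FinitePlace k) : MilnorRing v.ResidueField →+ MilnorRing k :=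
  AddMonoidHom.mk' (fun x => -(tameInfinity k).res (exists_res_eq v x).choose) fun x y => by
    have h := (exists_res_eq v (x + y)).choose_spec
    have hx := (exists_res_eq v x).choose_spec
    have hy := (exists_res_eq v y).choose_spec
    rw [← neg_add, ← map_add, neg_inj, ← sub_eq_zero, ← map_sub]
    refine res_infinity_eq_zero fun w => ?_
    by_cases hw : w = v
    · subst hw
      rw [map_sub, map_add, h.1, hx.1, hy.1, sub_self]
    · rw [map_sub, map_add, h.2 w hw, hx.2 w hw, hy.2 w hw, add_zero, sub_zero]

lemma transfer_eq (v : FinitePlace k) {z : MilnorRing (Polynomial k)}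
    (h : ∀ w : FinitePlace k, w ≠ v → w.tame.res z = 0) :
    v.transfer (v.tame.res z) = -(tameInfinity k).res z := by
  have h' := (exists_res_eq v (v.tame.res z)).choose_spec
  rw [transfer, AddMonoidHom.mk'_apply, neg_inj, ← sub_eq_zero, ← map_sub]
  refine res_infinity_eq_zero fun w => ?_
  by_cases hw : w = v
  · subst hw
    rw [map_sub, h'.1, sub_self]
  · rw [map_sub, h w hw, h'.2 w hw, sub_self]

lemma spec_constant (v : FinitePlace k) (x : MilnorRing k) :
    v.tame.spec (map Polynomial.C Polynomial.C_injective x) =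
      map (AdjoinRoot.of v.1) (AdjoinRoot.of v.1).injective x := by
  refine DFunLike.congr_fun (f := v.tame.spec.comp (map Polynomial.C Polynomial.C_injective))
    (ringHom_ext fun c => ?_) x
  rw [RingHom.comp_apply, map_sym, map_sym, TameDatum.spec_sym, tame_lc]
  by_cases hc : c = 0
  · simp [hc, leadingCoefficient]
  · rw [v.leadingCoefficient_of_not_dvd, AdjoinRoot.mk_C]
    exact v.not_dvd_of_natDegree_lt (Polynomial.C_ne_zero.mpr hc) (by simpa using v.deg_pos)

lemma constant_mem_degreeLT (x : MilnorRing k) :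
    map Polynomial.C Polynomial.C_injective x ∈ degreeLT k 1 := by
  have hx : x ∈ Subring.closure (Set.range (sym : k → _)) := by
    rw [closure_range_sym]; trivial
  induction hx using Subring.closure_induction with
  | mem x hx =>
    obtain ⟨c, rfl⟩ := hx
    rw [map_sym]
    exact sym_mem_degreeLT (by simp)
  | zero => simp [zero_mem]
  | one => simp [one_mem]
  | neg x _ hx => rw [map_neg]; exact neg_mem hx
  | add x y _ _ hx hy => rw [map_add]; exact add_mem hx hy
  | mul x y _ _ hx hy => rw [map_mul]; exact mul_mem hx hy

lemma constant_mem_kerRes (v : FinitePlace k) (x : MilnorRing k) :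
    map Polynomial.C Polynomial.C_injective x ∈ v.tame.kerRes :=
  v.degreeLT_le_kerRes v.deg_pos (constant_mem_degreeLT x)

lemma spec_infinity_constant (x : MilnorRing k) :
    (tameInfinity k).spec (map Polynomial.C Polynomial.C_injective x) = x := by
  refine DFunLike.congr_fun
    (f := (tameInfinity k).spec.comp (map Polynomial.C Polynomial.C_injective))
    (g := RingHom.id _) (ringHom_ext fun c => ?_) x
  simp [tameInfinity]

theorem transfer_map (v : FinitePlace k) (x : MilnorRing k) :
    v.transfer (map (AdjoinRoot.of v.1) (AdjoinRoot.of v.1).injective x) = v.deg • x := by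
  have h := v.transfer_eq (z := sym v.1 * map Polynomial.C Polynomial.C_injective x) fun w hw =>
    mul_mem (w.sym_mem_kerRes (not_dvd_of_ne hw)) (w.constant_mem_kerRes x)
  rw [v.res_sym_self_mul (v.constant_mem_kerRes x), spec_constant, TameDatum.res_mul,
    degreeLT_one_le_kerRes (constant_mem_degreeLT x), spec_infinity_constant] at h
  rw [h]
  simp [tameInfinity, deg]

theorem transfer_sym_root_mul (v : FinitePlace k) (hv : v.1.coeff 0 ≠ 0) (x : MilnorRing k) :
    v.transfer (sym (AdjoinRoot.root v.1) *
      map (AdjoinRoot.of v.1) (AdjoinRoot.of v.1).injective x) =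
        sym ((-1) ^ v.deg * v.1.coeff 0) * x := by
  obtain ⟨w₀, hw₀X⟩ : ∃ w : FinitePlace k, w.1 = Polynomial.X :=
    ⟨⟨Polynomial.X, Polynomial.monic_X, Polynomial.irreducible_X⟩, rfl⟩
  have hvw : w₀ ≠ v := by
    intro h
    rw [← h, hw₀X] at hv
    simp at hv
  set c := map Polynomial.C (Polynomial.C_injective (R := k)) x with hc
  set b : k := v.1.coeff 0 with hb
  have hX : sym (Polynomial.X : Polynomial k) ∈ v.tame.kerRes :=
    v.sym_mem_kerRes (hw₀X ▸ not_dvd_of_ne hvw.symm)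
  have hCb : ∀ w : FinitePlace k, sym (Polynomial.C b) ∈ w.tame.kerRes := fun w => by
    rw [← map_sym Polynomial.C Polynomial.C_injective]
    exact w.constant_mem_kerRes _
  have hcw := fun w : FinitePlace k => w.constant_mem_kerRes x
  have hlc : w₀.leadingCoefficient v.1 = AdjoinRoot.of w₀.1 b := by
    rw [w₀.leadingCoefficient_of_not_dvd (not_dvd_of_ne hvw), ← AdjoinRoot.mk_C,
      AdjoinRoot.mk_eq_mk]
    rw [hw₀X, Polynomial.X_dvd_iff]
    simp [hb]
  have h := v.transfer_eq (z := sym v.1 * (sym Polynomial.X * c) +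
      sym Polynomial.X * (sym (Polynomial.C b) * c)) fun w hw => by
    by_cases hw₀ : w = w₀
    · obtain rfl : w₀ = w := hw₀.symm
      have hXc : w₀.tame.res (sym Polynomial.X * c) = w₀.tame.spec c := by
        rw [← hw₀X]
        exact w₀.res_sym_self_mul (hcw _)
      have hXbc : w₀.tame.res (sym Polynomial.X * (sym (Polynomial.C b) * c)) =
          w₀.tame.spec (sym (Polynomial.C b) * c) := by
        rw [← hw₀X]
        exact w₀.res_sym_self_mul (mul_mem (hCb _) (hcw _))
      have h0 : w₀.tame.res (sym v.1) = 0 := w₀.sym_mem_kerRes (not_dvd_of_ne hw)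
      have h1 : w₀.tame.spec (sym (Polynomial.C b)) = sym (AdjoinRoot.of w₀.1 b) := by
        rw [← map_sym Polynomial.C Polynomial.C_injective, spec_constant, map_sym]
      rw [map_add, TameDatum.res_mul, h0, hXbc, hXc, map_mul _ (sym _) c, map_mul _ _ c,
        h1, TameDatum.spec'_sym, tame_ord, tame_lc, hlc, w₀.order_of_not_dvd (not_dvd_of_ne hw)]
      simp
    · have hXw : sym (Polynomial.X : Polynomial k) ∈ w.tame.kerRes :=
        w.sym_mem_kerRes (hw₀X ▸ not_dvd_of_ne hw₀)
      exact add_mem (mul_mem (w.sym_mem_kerRes (not_dvd_of_ne hw)) (mul_mem hXw (hcw w)))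
        (mul_mem hXw (mul_mem (hCb w) (hcw w)))
  have h2 : v.tame.res (sym Polynomial.X * (sym (Polynomial.C b) * c)) = 0 :=
    mul_mem hX (mul_mem (hCb v) (hcw v))
  have hc0 : (tameInfinity k).res c = 0 := degreeLT_one_le_kerRes (constant_mem_degreeLT x)
  have hbc0 : (tameInfinity k).res (sym (Polynomial.C b)) = 0 := by simp [tameInfinity]
  have hc1 : (tameInfinity k).spec c = x := spec_infinity_constant x
  rw [map_add, h2, add_zero, v.res_sym_self_mul (mul_mem hX (hcw v)), map_mul, spec_constant,
    TameDatum.spec_sym, tame_lc, v.leadingCoefficient_of_not_dvd (hw₀X ▸ not_dvd_of_ne hvw.symm),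
    AdjoinRoot.mk_X] at h
  rw [h, map_add, TameDatum.res_mul, TameDatum.res_mul, TameDatum.res_mul, TameDatum.res_mul, hc0,
    hbc0, map_mul, map_mul, hc1, sym_mul (pow_ne_zero _ (by simp)) hv, sym_pow (by simp)]
  simp [tameInfinity, v.2.1.leadingCoeff, deg, add_mul, sub_eq_add_neg]
  rw [add_comm, ← neg_mul, ← mul_neg, neg_eq_of_add_eq_zero_left sym_neg_one_add_self]

end FinitePlace

end Transfer

/-! ### The property `C_n` and finite extensions -/

section CField

lemma eval_bind₁_apply {R σ τ : Type*} [CommRing R] (x : τ → R) (g : σ → MvPolynomial τ R)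
    (f : MvPolynomial σ R) : eval x (bind₁ g f) = eval (fun i => eval x (g i)) f := by
  have h := aeval_bind₁ (R := R) (f := x) g f
  simpa only [← aeval_eq_eval] using h

lemma IsCField.exists_eval_eq_zero {k : Type u} [Field k] {n : ℕ} (hk : IsCField k n)
    {ι : Type*} [Fintype ι] {d : ℕ} (hd : 0 < d) (h : d ^ n < Fintype.card ι)
    {f : MvPolynomial ι k} (hf : f.IsHomogeneous d) :
    ∃ x : ι → k, x ≠ 0 ∧ eval x f = 0 := by
  obtain ⟨x, hx, h0⟩ := hk d _ hd h (rename (Fintype.equivFin ι) f) hf.rename_isHomogeneous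
  refine ⟨x ∘ Fintype.equivFin ι, fun h => hx ?_, by rwa [eval_rename] at h0⟩
  ext i
  simpa using congrFun h ((Fintype.equivFin ι).symm i)

/-- Iterated self-substitution of a polynomial without nontrivial zeros. -/
lemma exists_iterate_isHomogeneous {k : Type*} [Field k] {N d : ℕ} {f : MvPolynomial (Fin N) k}
    (hf : f.IsHomogeneous d) (h : ∀ x, eval x f = 0 → x = 0) (s : ℕ) :
    ∃ (ι : Type) (_ : Fintype ι) (g : MvPolynomial ι k), Fintype.card ι = N ^ s ∧
      g.IsHomogeneous (d ^ s) ∧ ∀ x, eval x g = 0 → x = 0 := by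
  induction s with
  | zero =>
    refine ⟨Unit, inferInstance, X (), by simp, isHomogeneous_X _ _, fun x hx => ?_⟩
    ext i
    simpa using hx
  | succ s ih =>
    obtain ⟨ι, _, g, hι, hg, h0⟩ := ih
    refine ⟨Fin N × ι, inferInstance, bind₁ (fun i => rename (Prod.mk i) g) f, ?_, ?_,
      fun x hx => ?_⟩
    · rw [Fintype.card_prod, Fintype.card_fin, hι, pow_succ']
    · rw [pow_succ]
      exact hf.aeval _ fun i => hg.rename_isHomogeneous
    · rw [eval_bind₁_apply] at hx
      ext ⟨i, j⟩
      have h1 := congrFun (h _ hx) i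
      rw [eval_rename] at h1
      exact congrFun (h0 _ h1) j

/-- A linear functional applied to the coefficients of a polynomial. -/
lemma exists_isHomogeneous_of_functional {k E : Type*} [Field k] [Field E] [Algebra k E]
    (φ : E →ₗ[k] k) {σ : Type*} {d : ℕ} {f : MvPolynomial σ E} (hf : f.IsHomogeneous d) :
    ∃ g : MvPolynomial σ k, g.IsHomogeneous d ∧
      ∀ x : σ → k, eval x g = φ (eval (fun i => algebraMap k E (x i)) f) := by
  refine ⟨∑ m ∈ f.support, monomial m (φ (f.coeff m)), IsHomogeneous.sum _ _ _ fun m hm =>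
    isHomogeneous_monomial _ ?_, fun x => ?_⟩
  · by_contra h
    exact mem_support_iff.mp hm (hf.coeff_eq_zero h)
  · rw [map_sum, eval_eq, map_sum]
    refine Finset.sum_congr rfl fun m _ => ?_
    simp only [eval_monomial, Finsupp.prod, ← map_pow, ← map_prod]
    rw [mul_comm (f.coeff m), ← Algebra.smul_def, map_smul, smul_eq_mul, mul_comm]

/-- The norm form of a polynomial over a finite extension. -/
lemma exists_isHomogeneous_norm {k E : Type*} [Field k] [Field E] [Algebra k E]
    [FiniteDimensional k E] {ι : Type*} [Fintype ι] {d : ℕ} {f : MvPolynomial ι E}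
    (hf : f.IsHomogeneous d) (h : ∀ x, eval x f = 0 → x = 0) :
    ∃ g : MvPolynomial (ι × Fin (Module.finrank k E)) k,
      g.IsHomogeneous (d * Module.finrank k E) ∧ ∀ x, eval x g = 0 → x = 0 := by
  set ω := Module.finBasis k E
  set f' : MvPolynomial (ι × Fin (Module.finrank k E)) E :=
    bind₁ (fun i => ∑ j, C (ω j) * X (i, j)) f with hf'
  have hf'd : f'.IsHomogeneous (1 * d) := hf.aeval _ fun i =>
    IsHomogeneous.sum _ _ _ fun j _ => isHomogeneous_C_mul_X _ _
  rw [one_mul] at hf'd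
  choose c hc hcx using fun j => exists_isHomogeneous_of_functional (ω.coord j) hf'd
  let M : Matrix (Fin (Module.finrank k E)) (Fin (Module.finrank k E))
      (MvPolynomial (ι × Fin (Module.finrank k E)) k) :=
    fun a b => ∑ j, C (Algebra.leftMulMatrix ω (ω j) a b) * c j
  refine ⟨M.det, ?_, fun x hx => ?_⟩
  · rw [Matrix.det_apply]
    refine IsHomogeneous.sum _ _ _ fun σ _ => ?_
    have hp : (∏ i, M (σ i) i).IsHomogeneous (∑ _ : Fin (Module.finrank k E), d) :=
      IsHomogeneous.prod _ _ _ fun i _ => IsHomogeneous.sum _ _ _ fun j _ => (hc j).C_mul _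
    rw [Finset.sum_const, Finset.card_univ, Fintype.card_fin, smul_eq_mul, mul_comm] at hp
    rcases Int.units_eq_one_or (Equiv.Perm.sign σ) with h | h
    · simpa [h] using hp
    · simpa [h] using hp.neg
  · rw [RingHom.map_det] at hx
    set y := eval (fun i => algebraMap k E (x i)) f' with hy
    have hM : (eval x).mapMatrix M = Algebra.leftMulMatrix ω y := by
      conv_rhs => rw [← ω.sum_repr y, map_sum]
      ext a b
      rw [RingHom.mapMatrix_apply, Matrix.map_apply]
      simp only [M, map_sum, map_mul, eval_C, hcx,
        Matrix.sum_apply, map_smul, Matrix.smul_apply, smul_eq_mul, Module.Basis.coord_apply]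
      exact Finset.sum_congr rfl fun j _ => mul_comm _ _
    rw [hM, ← Algebra.norm_eq_matrix_det, Algebra.norm_eq_zero_iff, hy, hf', eval_bind₁_apply] at hx
    ext ⟨i, j⟩
    have h1 := congrFun (h _ hx) i
    simp only [map_sum, map_mul, eval_C, eval_X, Pi.zero_apply] at h1
    have h2 := Fintype.linearIndependent_iff.mp ω.linearIndependent (fun j => x (i, j))
      (by simpa [Algebra.smul_def, mul_comm] using h1)
    exact h2 j

theorem IsCField.of_finite {k E : Type u} [Field k] [Field E] [Algebra k E]
    [FiniteDimensional k E] {n : ℕ} (hk : IsCField k n) : IsCField E n := by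
  intro d N hd hN f hf
  by_contra! h
  have h' : ∀ x, eval x f = 0 → x = 0 := fun x hx => by
    by_contra h0
    exact h x h0 hx
  set m := Module.finrank k E with hm
  have hm0 : 0 < m := Module.finrank_pos
  obtain ⟨s, hs⟩ : ∃ s, m ^ n * (d ^ n) ^ s < N ^ s := by
    have hd' : (0 : ℝ) < (d : ℝ) ^ n := by positivity
    obtain ⟨s, hs⟩ := pow_unbounded_of_one_lt ((m : ℝ) ^ n)
      (show 1 < (N : ℝ) / (d : ℝ) ^ n by rw [one_lt_div hd']; exact_mod_cast hN)
    refine ⟨s, ?_⟩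
    rw [div_pow, lt_div_iff₀ (pow_pos hd' s)] at hs
    exact_mod_cast hs
  obtain ⟨ι, _, g, hι, hg, hg0⟩ := exists_iterate_isHomogeneous hf h' s
  obtain ⟨q, hq, hq0⟩ := exists_isHomogeneous_norm (k := k) hg hg0
  obtain ⟨x, hx, hx0⟩ := hk.exists_eval_eq_zero (mul_pos (pow_pos hd s) hm0) (by
    rw [Fintype.card_prod, hι, Fintype.card_fin, mul_pow, ← pow_mul, mul_comm s n, pow_mul]
    calc (d ^ n) ^ s * m ^ n = m ^ n * (d ^ n) ^ s := mul_comm _ _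
      _ < N ^ s := hs
      _ ≤ N ^ s * m := Nat.le_mul_of_pos_right _ hm0) hq
  exact hx (hq0 x hx0)

end CField

/-! ### The norm form of a symbol algebra -/

section NormForm

open Matrix

variable {R S : Type*} [CommRing R] [CommRing S] {p : ℕ}

/-- The weighted cyclic shift, whose `p`-th power is `b`. -/
def cyclicShift (p : ℕ) (b : R) : Matrix (Fin p) (Fin p) R := fun i j =>
  if (j : ℕ) + 1 = i then 1 else if (i : ℕ) = 0 ∧ (j : ℕ) + 1 = p then b else 0

/-- The element of the split symbol algebra with given coordinates. -/
def symbolMatrix (ζ u b : R) (x : Fin p × Fin p → R) : Matrix (Fin p) (Fin p) R :=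
  ∑ ij : Fin p × Fin p,
    x ij • (diagonal (fun k : Fin p => ζ ^ (k : ℕ) * u) ^ (ij.1 : ℕ) * cyclicShift p b ^ (ij.2 : ℕ))

lemma cyclicShift_map (φ : R →+* S) (b : R) :
    φ.mapMatrix (cyclicShift p b) = cyclicShift p (φ b) := by
  ext i j
  simp [cyclicShift, apply_ite φ]

lemma symbolMatrix_map (φ : R →+* S) (ζ u b : R) (x : Fin p × Fin p → R) :
    φ.mapMatrix (symbolMatrix ζ u b x) = symbolMatrix (φ ζ) (φ u) (φ b) (φ ∘ x) := by
  have hd : φ.mapMatrix (diagonal (fun k : Fin p => ζ ^ (k : ℕ) * u)) =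
      diagonal (fun k : Fin p => φ ζ ^ (k : ℕ) * φ u) := by
    rw [RingHom.mapMatrix_apply, diagonal_map (map_zero φ)]
    simp
  have hs : ∀ (c : R) (N : Matrix (Fin p) (Fin p) R), φ.mapMatrix (c • N) = φ c • φ.mapMatrix N :=
    fun c N => by ext; simp
  rw [symbolMatrix, map_sum]
  simp only [hs, map_mul, map_pow, hd, cyclicShift_map]
  rfl

lemma cyclicShift_mulVec_single_of_lt (b : R) (j : ℕ) (h : j + 1 < p) :
    cyclicShift p b *ᵥ Pi.single ⟨j, by omega⟩ 1 = Pi.single ⟨j + 1, h⟩ 1 := by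
  ext i
  rw [mulVec_single_one, Matrix.col_apply, cyclicShift, Pi.single_apply]
  simp only [Fin.ext_iff]
  split_ifs <;> first | rfl | omega

lemma cyclicShift_pow_mulVec_single (b : R) (h0 : 0 < p) (j : ℕ) (h : j < p) :
    cyclicShift p b ^ j *ᵥ Pi.single ⟨0, h0⟩ 1 = Pi.single ⟨j, h⟩ 1 := by
  induction j with
  | zero => rw [pow_zero, one_mulVec]
  | succ j ih =>
    rw [pow_succ', ← mulVec_mulVec, ih (by omega), cyclicShift_mulVec_single_of_lt b j h]

lemma cyclicShift_pow_self (b : R) : cyclicShift p b ^ p = scalar (Fin p) b := by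
  rcases Nat.eq_zero_or_pos p with rfl | h0
  · exact Subsingleton.elim _ _
  have h1 : cyclicShift p b ^ p *ᵥ Pi.single ⟨0, h0⟩ 1 = b • Pi.single ⟨0, h0⟩ 1 := by
    obtain ⟨q, rfl⟩ : ∃ q, p = q + 1 := ⟨p - 1, by omega⟩
    rw [pow_succ', ← mulVec_mulVec, cyclicShift_pow_mulVec_single b h0 q (by omega)]
    ext i
    rw [mulVec_single_one, Matrix.col_apply, cyclicShift, Pi.smul_apply, Pi.single_apply]
    have := i.2
    rw [if_neg (by simp only; omega)]
    by_cases hi : (i : ℕ) = 0 <;> simp [Fin.ext_iff, hi]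
  refine Matrix.ext_of_mulVec_single fun j => ?_
  rw [← cyclicShift_pow_mulVec_single b h0 j j.2, mulVec_mulVec, ← pow_add, add_comm, pow_add,
    ← mulVec_mulVec, h1, mulVec_smul]
  ext i
  simp

lemma diagonal_mul_cyclicShift {ζ : R} (hζ : ζ ^ p = 1) (u b : R) :
    diagonal (fun k : Fin p => ζ ^ (k : ℕ) * u) * cyclicShift p b =
      cyclicShift p b * diagonal (fun k : Fin p => ζ ^ (k : ℕ) * (ζ * u)) := by
  ext i j
  rw [diagonal_mul, mul_diagonal, cyclicShift]
  split_ifs with h h'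
  · rw [← h]; ring
  · have h1 : ζ ^ (j : ℕ) * ζ = 1 := by rw [← pow_succ, h'.2, hζ]
    rw [h'.1]
    linear_combination (-(b * u)) * h1
  · ring

lemma symbolMatrix_mul_cyclicShift {ζ : R} (hζ : ζ ^ p = 1) (u b : R) (x : Fin p × Fin p → R) :
    symbolMatrix ζ u b x * cyclicShift p b = cyclicShift p b * symbolMatrix ζ (ζ * u) b x := by
  rw [symbolMatrix, symbolMatrix, Finset.sum_mul, Finset.mul_sum]
  refine Finset.sum_congr rfl fun ij _ => ?_
  have h : SemiconjBy (cyclicShift p b) (diagonal (fun k : Fin p => ζ ^ (k : ℕ) * (ζ * u)))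
    (diagonal (fun k : Fin p => ζ ^ (k : ℕ) * u)) := (diagonal_mul_cyclicShift hζ u b).symm
  rw [smul_mul_assoc, mul_smul_comm, mul_assoc, ← pow_succ, pow_succ', ← mul_assoc, ← mul_assoc,
    (h.pow_right _).eq]

lemma symbolMatrix_mulVec_single (ζ u b : R) (x : Fin p × Fin p → R) (h0 : 0 < p) (j : Fin p) :
    (symbolMatrix ζ u b x *ᵥ Pi.single ⟨0, h0⟩ 1) j =
      ∑ i : Fin p, x (i, j) * (ζ ^ (j : ℕ) * u) ^ (i : ℕ) := by
  rw [symbolMatrix, sum_mulVec, Finset.sum_apply, Fintype.sum_prod_type]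
  refine Finset.sum_congr rfl fun i _ => ?_
  rw [Finset.sum_eq_single j]
  · rw [smul_mulVec, ← mulVec_mulVec, cyclicShift_pow_mulVec_single b h0 j j.2, diagonal_pow]
    simp
  · intro l _ hl
    rw [smul_mulVec, ← mulVec_mulVec, cyclicShift_pow_mulVec_single b h0 l l.2, diagonal_pow]
    simp [hl.symm]
  · simp

lemma det_symbolMatrix_mul [IsDomain R] {ζ : R} (hζ : ζ ^ p = 1) (u : R) {b : R} (hb : b ≠ 0)
    (x : Fin p × Fin p → R) :
    (symbolMatrix ζ (ζ * u) b x).det = (symbolMatrix ζ u b x).det := by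
  have hdet : (cyclicShift p b).det ≠ 0 := by
    intro h
    have h1 := congrArg det (cyclicShift_pow_self (p := p) b)
    rw [det_pow, h] at h1
    rcases Nat.eq_zero_or_pos p with rfl | h0
    · simp at h
    · rw [zero_pow h0.ne', scalar_apply, det_diagonal] at h1
      exact (Finset.prod_ne_zero_iff.mpr fun _ _ => hb) h1.symm
  have h := congrArg det (symbolMatrix_mul_cyclicShift hζ u b x)
  rw [det_mul, det_mul, mul_comm] at h
  exact (mul_left_cancel₀ hdet h).symm

end NormForm

section ReducedNorm

open Matrix

variable {k : Type*} [Field k] {p : ℕ}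

/-- The determinant of the generic element of a split symbol algebra. -/
noncomputable def genericDet (p : ℕ) (ζ b : k) : Polynomial (MvPolynomial (Fin p × Fin p) k) :=
  (symbolMatrix (Polynomial.C (C ζ)) Polynomial.X (Polynomial.C (C b))
    (fun ij => Polynomial.C (X ij))).det

/-- The reduced norm form of the symbol algebra with slots `a` and `b`. -/
noncomputable def normForm (p : ℕ) (ζ a b : k) : MvPolynomial (Fin p × Fin p) k :=
  ((genericDet p ζ b).contract p).eval (C a)

lemma isHomogeneous_coeff_prod {ι σ : Type*} (s : Finset ι)
    (g : ι → Polynomial (MvPolynomial σ k)) (h : ∀ i n, ((g i).coeff n).IsHomogeneous 1) (n : ℕ) :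
    ((∏ i ∈ s, g i).coeff n).IsHomogeneous s.card := by
  classical
  induction s using Finset.induction_on generalizing n with
  | empty =>
    rw [Finset.prod_empty, Polynomial.coeff_one]
    split_ifs
    · exact isHomogeneous_one _ _
    · exact isHomogeneous_zero _ _ _
  | insert i s hi ih =>
    rw [Finset.prod_insert hi, Polynomial.coeff_mul, Finset.card_insert_of_notMem hi, add_comm]
    exact IsHomogeneous.sum _ _ _ fun m _ => (h i m.1).mul (ih m.2)

lemma isHomogeneous_coeff_genericDet (ζ b : k) (n : ℕ) :
    ((genericDet p ζ b).coeff n).IsHomogeneous p := by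
  have hM : ∀ r s n, ((symbolMatrix (Polynomial.C (C ζ)) Polynomial.X (Polynomial.C (C b))
      (fun ij : Fin p × Fin p => Polynomial.C (X ij : MvPolynomial (Fin p × Fin p) k))
        r s).coeff n).IsHomogeneous 1 := by
    intro r s n
    let φ : Polynomial k →+* Polynomial (MvPolynomial (Fin p × Fin p) k) := Polynomial.mapRingHom C
    have hN : ∀ ij : Fin p × Fin p,
        diagonal (fun k : Fin p => Polynomial.C (C ζ) ^ (k : ℕ) * Polynomial.X) ^ (ij.1 : ℕ) *
          cyclicShift p (Polynomial.C (C b)) ^ (ij.2 : ℕ) =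
        φ.mapMatrix (diagonal (fun k : Fin p => Polynomial.C ζ ^ (k : ℕ) * Polynomial.X) ^
          (ij.1 : ℕ) * cyclicShift p (Polynomial.C b) ^ (ij.2 : ℕ)) := by
      intro ij
      rw [map_mul, map_pow, map_pow, cyclicShift_map, RingHom.mapMatrix_apply,
        diagonal_map (map_zero φ)]
      simp [φ]
    rw [symbolMatrix, Matrix.sum_apply, Polynomial.finsetSum_coeff]
    refine IsHomogeneous.sum _ _ _ fun ij _ => ?_
    rw [hN, Matrix.smul_apply, RingHom.mapMatrix_apply, Matrix.map_apply, smul_eq_mul,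
      Polynomial.coeff_C_mul, Polynomial.coe_mapRingHom, Polynomial.coeff_map]
    exact (isHomogeneous_X _ _).mul (isHomogeneous_C _ _)
  rw [genericDet, det_apply, Polynomial.finsetSum_coeff]
  refine IsHomogeneous.sum _ _ _ fun σ _ => ?_
  have h1 := isHomogeneous_coeff_prod Finset.univ _ (fun i => hM (σ i) i) n
  rw [Finset.card_univ, Fintype.card_fin] at h1
  rcases Int.units_eq_one_or (Equiv.Perm.sign σ) with h | h
  · simpa [h] using h1
  · simpa [h] using h1.neg

lemma normForm_isHomogeneous (hp : p ≠ 0) (ζ a b : k) : (normForm p ζ a b).IsHomogeneous p := by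
  rw [normForm, Polynomial.eval_eq_sum]
  refine IsHomogeneous.sum _ _ _ fun n _ => ?_
  simp only [Polynomial.coeff_contract hp, ← C_pow]
  exact (isHomogeneous_coeff_genericDet ζ b _).mul (isHomogeneous_C _ _)

lemma expand_contract_genericDet {ζ : k} (hζ : IsPrimitiveRoot ζ p) (hp : 0 < p) {b : k}
    (hb : b ≠ 0) : Polynomial.expand _ p ((genericDet p ζ b).contract p) = genericDet p ζ b := by
  have hcomp : (genericDet p ζ b).comp (Polynomial.C (C ζ) * Polynomial.X) = genericDet p ζ b := by
    rw [← Polynomial.coe_compRingHom_apply, genericDet, RingHom.map_det, symbolMatrix_map]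
    have h1 : (Polynomial.C (C ζ) : Polynomial (MvPolynomial (Fin p × Fin p) k)) ^ p = 1 := by
      rw [← map_pow, ← map_pow, hζ.pow_eq_one, map_one, map_one]
    have h2 := det_symbolMatrix_mul h1 Polynomial.X (b := Polynomial.C (C b)) (by simpa using hb)
      (fun ij => Polynomial.C (X ij))
    simpa [Function.comp_def] using h2
  ext1 n
  rw [Polynomial.coeff_expand hp]
  split_ifs with h
  · rw [Polynomial.coeff_contract hp.ne', Nat.div_mul_cancel h]
  · have h1 := congrArg (fun q => Polynomial.coeff q n) hcomp
    simp only [Polynomial.comp_C_mul_X_coeff] at h1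
    have h2 : (C (ζ ^ n - 1) : MvPolynomial (Fin p × Fin p) k) *
        (genericDet p ζ b).coeff n = 0 := by
      rw [C_sub, C_pow, C_1]
      linear_combination h1
    rcases mul_eq_zero.mp h2 with h3 | h3
    · rw [C_eq_zero, sub_eq_zero] at h3
      exact absurd (hζ.dvd_of_pow_eq_one n h3) h
    · exact h3.symm

theorem eval₂_normForm {ζ : k} (hζ : IsPrimitiveRoot ζ p) (hp : 0 < p) {b : k} (hb : b ≠ 0) (a : k)
    {R : Type*} [CommRing R] (φ : k →+* R) {α : R} (hα : α ^ p = φ a) (x : Fin p × Fin p → R) :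
    (normForm p ζ a b).eval₂ φ x = (symbolMatrix (φ ζ) α (φ b) x).det := by
  let ψ : Polynomial (MvPolynomial (Fin p × Fin p) k) →+* R :=
    Polynomial.eval₂RingHom (eval₂Hom φ x) α
  have h : ψ (genericDet p ζ b) = (symbolMatrix (φ ζ) α (φ b) x).det := by
    rw [genericDet, RingHom.map_det, symbolMatrix_map]
    simp [ψ, Function.comp_def]
  rw [← h, ← expand_contract_genericDet hζ hp hb, Polynomial.coe_eval₂RingHom,
    Polynomial.expand_eq_comp_X_pow, Polynomial.eval₂_comp, Polynomial.eval₂_X_pow, hα,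
    ← eval₂_C φ x a, ← coe_eval₂Hom, Polynomial.eval₂_at_apply, normForm, coe_eval₂Hom]

end ReducedNorm

/-! ### Isotropic norm forms and divisible symbols -/

section TwistedNorm

open Matrix

variable {L : Type*} [Field L] {p : ℕ}

/-- A singular matrix commuting semilinearly with a `p`-th root `B` of the scalar `b` makes a power
of `b` a twisted norm. -/
theorem exists_prod_eq_pow_of_det_eq_zero (σ : L →+* L) (hσ : σ ^ p = 1)
    {M B : Matrix (Fin p) (Fin p) L} {b : L} (hB : B ^ p = scalar (Fin p) b) (hσB : B.map σ = B)
    (hMB : M * B = B * M.map σ) (hdet : M.det = 0) (hM : M ≠ 0) :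
    ∃ e, 0 < e ∧ e < p ∧ ∃ y : L, ∏ i ∈ Finset.range p, (σ ^ i) y = b ^ e := by
  set J := LinearMap.ker M.mulVecLin with hJ
  set e := Module.finrank L J with he
  let v : Module.Basis (Fin e) L J := Module.finBasis L J
  let V : Matrix (Fin p) (Fin e) L := Matrix.of fun i j => (v j : Fin p → L) i
  have hVcol : ∀ c : Fin e → L, V *ᵥ c = ((∑ j, c j • v j : J) : Fin p → L) := by
    intro c
    ext i
    simp [V, mulVec, dotProduct, mul_comm]
  have hMV : M * V = 0 := by
    refine Matrix.ext_of_mulVec_single fun j => ?_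
    rw [← mulVec_mulVec, hVcol, zero_mulVec]
    exact (∑ i, _ • v i : J).2
  have hVinj : ∀ Y Y' : Matrix (Fin e) (Fin e) L, V * Y = V * Y' → Y = Y' := by
    intro Y Y' h
    refine Matrix.ext_of_mulVec_single fun j => ?_
    have h1 := congrArg (· *ᵥ Pi.single j 1) h
    simp only [← mulVec_mulVec, hVcol] at h1
    have h2 := Subtype.ext h1
    rw [← v.equivFun_symm_apply, ← v.equivFun_symm_apply] at h2
    exact v.equivFun.symm.injective h2
  have hVsurj : ∀ N : Matrix (Fin p) (Fin e) L, M * N = 0 →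
      ∃ Y : Matrix (Fin e) (Fin e) L, V * Y = N := by
    intro N hN
    have hmem : ∀ j, N.col j ∈ J := fun j => by
      rw [hJ, LinearMap.mem_ker, mulVecLin_apply]
      ext i
      exact congrFun (congrFun hN i) j
    refine ⟨Matrix.of fun i j => v.repr ⟨N.col j, hmem j⟩ i, ?_⟩
    ext i j
    have h := hVcol fun i => v.repr ⟨N.col j, hmem j⟩ i
    rw [v.sum_repr] at h
    exact congrFun h i
  obtain ⟨Y, hY⟩ := hVsurj (B * V.map σ) (by
    rw [← Matrix.mul_assoc, hMB, Matrix.mul_assoc, ← Matrix.map_mul, hMV]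
    simp)
  have hpow : ∀ i : ℕ, ∃ Z : Matrix (Fin e) (Fin e) L, B ^ i * V.map (σ ^ i) = V * Z ∧
      Z.det = ∏ j ∈ Finset.range i, (σ ^ j) Y.det := by
    intro i
    induction i with
    | zero => exact ⟨1, by ext; simp, by simp⟩
    | succ i ih =>
      obtain ⟨Z, hZ, hdet⟩ := ih
      refine ⟨Y * Z.map σ, ?_, ?_⟩
      · have hBi : (B ^ i).map σ = B ^ i := by
          have := map_pow σ.mapMatrix B i
          simpa only [RingHom.mapMatrix_apply, hσB] using this
        have hVi : (V.map (σ ^ i)).map σ = V.map (σ ^ (i + 1)) := by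
          ext
          simp [pow_succ']
        have h1 : B ^ i * V.map (σ ^ (i + 1)) = (V * Z).map σ := by
          rw [← hZ, Matrix.map_mul, hBi, hVi]
        rw [pow_succ', Matrix.mul_assoc, h1, Matrix.map_mul, ← Matrix.mul_assoc, ← hY,
          Matrix.mul_assoc]
      · have h1 := (σ.map_det Z).symm
        rw [RingHom.mapMatrix_apply] at h1
        rw [det_mul, h1, hdet, map_prod, Finset.prod_range_succ', mul_comm]
        simp [pow_succ']
  obtain ⟨Z, hZ, hdetZ⟩ := hpow p
  have hZb : Z = scalar (Fin e) b := by
    refine hVinj _ _ ?_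
    rw [← hZ, hB, hσ]
    ext
    simp [mul_comm]
  refine ⟨e, ?_, ?_, Y.det, ?_⟩
  · obtain ⟨w, hw, hw0⟩ := exists_mulVec_eq_zero_iff.mpr hdet
    rw [he, Module.finrank_pos_iff_exists_ne_zero]
    exact ⟨⟨w, hw0⟩, fun h => hw (congrArg Subtype.val h)⟩
  · have hlt : J ≠ ⊤ := by
      intro h
      refine hM (Matrix.ext_of_mulVec_single fun j => ?_)
      rw [zero_mulVec]
      exact (h ▸ Submodule.mem_top : Pi.single j 1 ∈ J)
    simpa using Submodule.finrank_lt hlt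
  · rw [← hdetZ, hZb]
    simp

end TwistedNorm

section Norm

open MilnorRing

lemma MilnorRing.natCast_dvd_mul {R : Type*} [CommRing R] {p : ℕ} {x : MilnorRing R}
    (h : (p : MilnorRing R) ∣ x) (z : MilnorRing R) : (p : MilnorRing R) ∣ z * x := by
  obtain ⟨w, rfl⟩ := h
  exact ⟨z * w, by rw [← mul_assoc, ← mul_assoc, Nat.cast_comm]⟩

lemma AddMonoidHom.natCast_dvd_map {R S : Type*} [Ring R] [Ring S] (f : R →+ S) {p : ℕ} {x : R}
    (h : (p : R) ∣ x) : (p : S) ∣ f x := by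
  obtain ⟨w, rfl⟩ := h
  exact ⟨f w, by rw [← nsmul_eq_mul, map_nsmul, nsmul_eq_mul]⟩

/-- Bézout cancellation for divisibility by a prime. -/
lemma natCast_dvd_of_dvd_nsmul {R : Type*} [Ring R] {p e : ℕ} (h : Nat.Coprime e p) {x : R}
    (hx : (p : R) ∣ e • x) : (p : R) ∣ x := by
  obtain ⟨w, hw⟩ := hx
  rw [nsmul_eq_mul] at hw
  have h1 : (e : ℤ) * e.gcdA p + p * e.gcdB p = 1 := by
    rw [← Nat.gcd_eq_gcd_ab, h, Nat.cast_one]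
  have h2 := congrArg (fun n : ℤ => (n : R) * x) h1
  push_cast at h2
  rw [one_mul, add_mul, ← Int.cast_natCast, Int.cast_comm, mul_assoc, Int.cast_natCast, hw] at h2
  refine ⟨(e.gcdA p : R) * w + (e.gcdB p : R) * x, ?_⟩
  conv_lhs => rw [← h2]
  rw [mul_add, ← mul_assoc _ _ w, Int.cast_comm, ← Int.cast_natCast (R := R) p, mul_assoc,
    mul_assoc]

variable {E L : Type*} [Field E] [Field L] [Algebra E L]

/-- A norm from an extension of prime degree `p` kills, modulo `p`, every element which becomes a
`p`-th power in the extension. -/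
theorem natCast_dvd_sym_norm_mul {p : ℕ} (hp : p.Prime) (hL : Module.finrank E L = p) {a : E}
    {α : L} (hα : α ^ p = algebraMap E L a) {y : L} (hy : y ≠ 0) (ha : a ≠ 0) :
    (p : MilnorRing E) ∣ sym (Algebra.norm E y) * sym a := by
  have hfd : FiniteDimensional E L := Module.finite_of_finrank_pos (hL ▸ hp.pos)
  have hyint : IsIntegral E y := IsIntegral.of_finite E y
  rcases (Nat.dvd_prime hp).mp (hL ▸ minpoly.degree_dvd hyint) with h1 | h1
  · obtain ⟨c, rfl⟩ := minpoly.natDegree_eq_one_iff.mp h1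
    rw [Algebra.norm_algebraMap, hL, sym_pow (fun h => hy (by rw [h, map_zero])), nsmul_eq_mul,
      mul_assoc]
    exact dvd_mul_right _ _
  obtain ⟨v, hv⟩ : ∃ v : FinitePlace E, v.1 = minpoly E y :=
    ⟨⟨_, minpoly.monic hyint, minpoly.irreducible hyint⟩, rfl⟩
  have hdeg : v.deg = p := by rw [FinitePlace.deg, hv, h1]
  have hfin : Module.finrank E v.ResidueField = p := by
    rw [(AdjoinRoot.powerBasis v.2.1.ne_zero).finrank, AdjoinRoot.powerBasis_dim]
    exact hdeg
  let f : v.ResidueField →ₐ[E] L := AdjoinRoot.liftAlgHom v.1 (Algebra.ofId E L) y (by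
    rw [hv]; exact minpoly.aeval E y)
  have hfr : f (AdjoinRoot.root v.1) = y := AdjoinRoot.liftAlgHom_root _ _ _ _
  have hfi : Function.Injective f := f.injective
  have hfd' : FiniteDimensional E v.ResidueField := Module.finite_of_finrank_pos (hfin ▸ hp.pos)
  have hbij : Function.Bijective f :=
    ⟨hfi, (LinearMap.injective_iff_surjective_of_finrank_eq_finrank (f := f.toLinearMap)
      (hfin.trans hL.symm)).mp hfi⟩
  have hnorm : Algebra.norm E y = (-1) ^ v.deg * v.1.coeff 0 := by
    have h2 := Algebra.norm_eq_of_algEquiv (AlgEquiv.ofBijective f hbij) (AdjoinRoot.root v.1)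
    rw [AlgEquiv.coe_ofBijective, hfr] at h2
    rw [h2]
    have h3 := Algebra.PowerBasis.norm_gen_eq_coeff_zero_minpoly
      (AdjoinRoot.powerBasis v.2.1.ne_zero)
    rwa [AdjoinRoot.minpoly_powerBasis_gen_of_monic v.2.1, AdjoinRoot.powerBasis_gen,
      AdjoinRoot.powerBasis_dim] at h3
  obtain ⟨γ, hγ⟩ := hbij.2 α
  have hγa : γ ^ p = AdjoinRoot.of v.1 a := hfi (by
    rw [map_pow, hγ, hα, ← AdjoinRoot.algebraMap_eq, AlgHom.commutes])
  have hγ0 : γ ≠ 0 := by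
    rintro rfl
    rw [zero_pow hp.ne_zero, eq_comm, map_eq_zero] at hγa
    exact ha hγa
  have h0 : v.1.coeff 0 ≠ 0 := by
    rw [hv]; exact minpoly.coeff_zero_ne_zero hyint hy
  rw [hnorm, ← v.transfer_sym_root_mul h0, map_sym, ← hγa, sym_pow hγ0, nsmul_eq_mul]
  exact AddMonoidHom.natCast_dvd_map _ (natCast_dvd_mul (dvd_mul_right _ _) _)

end Norm

section KummerExtension

open Polynomial in
lemma adjoinRoot_sum_ne_zero {E : Type*} [Field E] {f : E[X]} {n : ℕ} (hf : f.natDegree = n)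
    {c : Fin n → E} (hc : c ≠ 0) :
    ∑ i, AdjoinRoot.of f (c i) * AdjoinRoot.root f ^ (i : ℕ) ≠ 0 := by
  intro h
  have h1 : AdjoinRoot.mk f (∑ i, Polynomial.C (c i) * Polynomial.X ^ (i : ℕ)) = 0 := by
    simpa using h
  rw [AdjoinRoot.mk_eq_zero] at h1
  have h2 := degree_sum_fin_lt c
  have h3 : ∑ i, Polynomial.C (c i) * Polynomial.X ^ (i : ℕ) = 0 := by
    by_cases hf0 : f = 0
    · rw [hf0, zero_dvd_iff] at h1
      exact h1
    · exact eq_zero_of_dvd_of_degree_lt h1 (by rwa [degree_eq_natDegree hf0, hf])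
  refine hc (funext fun i => ?_)
  have h4 := congrArg (fun q => Polynomial.coeff q i) h3
  simpa [finsetSum_coeff, Polynomial.coeff_X_pow, Fin.val_inj] using h4

open MilnorRing Matrix in
/-- If the norm form of a symbol algebra is isotropic then the corresponding symbol is divisible
by `p`. -/
theorem natCast_dvd_sym_mul_sym {E : Type u} [Field E] {p : ℕ} (hp : p.Prime) {ζ : E}
    (hζ : IsPrimitiveRoot ζ p) {a b : E} (ha : a ≠ 0) (hb : b ≠ 0) {x : Fin p × Fin p → E}
    (hx : x ≠ 0) (h : ∀ (K : Type u) [Field K] (φ : E →+* K) (α : K), α ^ p = φ a →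
      (symbolMatrix (φ ζ) α (φ b) (φ ∘ x)).det = 0) :
    (p : MilnorRing E) ∣ sym b * sym a := by
  by_cases hpow : ∃ α, α ^ p = a
  · obtain ⟨α, rfl⟩ := hpow
    rw [sym_pow (fun h0 => ha (by rw [h0, zero_pow hp.ne_zero])), nsmul_eq_mul]
    exact natCast_dvd_mul (dvd_mul_right _ _) _
  have hirr : Irreducible (Polynomial.X ^ p - Polynomial.C a) :=
    X_pow_sub_C_irreducible_of_prime hp fun α hα => hpow ⟨α, hα⟩
  have : Fact (Irreducible (Polynomial.X ^ p - Polynomial.C a)) := ⟨hirr⟩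
  have hp0 : NeZero p := ⟨hp.ne_zero⟩
  have hdeg : (Polynomial.X ^ p - Polynomial.C a).natDegree = p := Polynomial.natDegree_X_pow_sub_C
  set L := AdjoinRoot (Polynomial.X ^ p - Polynomial.C a) with hL
  set α : L := AdjoinRoot.root _ with hα
  have hαp : α ^ p = algebraMap E L a := root_X_pow_sub_C_pow p a
  have hα0 : α ≠ 0 := by
    intro h0
    rw [h0, zero_pow hp.ne_zero, eq_comm, map_eq_zero] at hαp
    exact ha hαp
  have hroots : (primitiveRoots p E).Nonempty := ⟨ζ, (mem_primitiveRoots hp.pos).mpr hζ⟩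
  have := isSplittingField_AdjoinRoot_X_pow_sub_C hroots hirr
  have hrank : Module.finrank E L = p := finrank_of_isSplittingField_X_pow_sub_C hroots hirr L
  have hfd : FiniteDimensional E L := Module.finite_of_finrank_pos (hrank.symm ▸ hp.pos)
  have hgal : IsGalois E L := isGalois_of_isSplittingField_X_pow_sub_C hroots hirr L
  obtain ⟨τ, hτp, hτ⟩ : ∃ τ : L ≃ₐ[E] L, τ ^ p = 1 ∧ τ α = algebraMap E L ζ * α := by
    refine ⟨autAdjoinRootXPowSubC p a (rootsOfUnity.mkOfPowEq ζ hζ.pow_eq_one), ?_, ?_⟩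
    · have h1 : rootsOfUnity.mkOfPowEq ζ hζ.pow_eq_one ^ p = 1 := by
        ext
        simp [hζ.pow_eq_one]
      exact (map_pow _ _ _).symm.trans ((congrArg _ h1).trans (map_one _))
    · rw [autAdjoinRootXPowSubC_root, ← Algebra.smul_def]
      rfl
  have hτi : ∀ i : ℕ, (τ ^ i) α = algebraMap E L (ζ ^ i) * α := by
    intro i
    induction i with
    | zero => simp
    | succ i ih => rw [pow_succ', AlgEquiv.mul_apply, ih, map_mul, AlgEquiv.commutes, hτ, pow_succ,
        map_mul, mul_assoc]
  have hnorm : ∀ y : L, algebraMap E L (Algebra.norm E y) = ∏ i ∈ Finset.range p, (τ ^ i) y := by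
    intro y
    have hinj : Function.Injective fun i : Fin p => τ ^ (i : ℕ) := by
      intro i j hij
      have h1 := congrArg (fun g : L ≃ₐ[E] L => g α) hij
      simp only [hτi, mul_left_inj' hα0] at h1
      exact Fin.ext (hζ.pow_inj i.2 j.2 ((algebraMap E L).injective h1))
    have hbij : Function.Bijective fun i : Fin p => τ ^ (i : ℕ) := by
      refine (Fintype.bijective_iff_injective_and_card _).mpr ⟨hinj, ?_⟩
      rw [← Nat.card_eq_fintype_card (α := L ≃ₐ[E] L), IsGalois.card_aut_eq_finrank, hrank,
        Fintype.card_fin]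
    rw [Algebra.norm_eq_prod_automorphisms, ← hbij.prod_comp, Finset.prod_range]
  let σ : L →+* L := (τ : L →+* L)
  have hσi : ∀ (i : ℕ) (y : L), (σ ^ i) y = (τ ^ i) y := by
    intro i
    induction i with
    | zero => intro y; simp
    | succ i ih => intro y; rw [pow_succ, pow_succ, RingHom.mul_def, RingHom.comp_apply, ih]; rfl
  set M : Matrix (Fin p) (Fin p) L :=
    symbolMatrix (algebraMap E L ζ) α (algebraMap E L b) (algebraMap E L ∘ x) with hM
  have hMσ : M.map σ =
      symbolMatrix (algebraMap E L ζ) (algebraMap E L ζ * α) (algebraMap E L b)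
        (algebraMap E L ∘ x) := by
    rw [← RingHom.mapMatrix_apply, hM, symbolMatrix_map, ← hτ]
    congr 1
    · exact τ.commutes _
    · exact τ.commutes _
    · exact funext fun _ => τ.commutes _
  have hM0 : M ≠ 0 := by
    intro h0
    obtain ⟨⟨i, j⟩, hij⟩ := Function.ne_iff.mp hx
    have h1 := congrFun (congrArg (· *ᵥ Pi.single ⟨0, hp.pos⟩ 1) h0) j
    simp only [hM, symbolMatrix_mulVec_single] at h1
    refine adjoinRoot_sum_ne_zero hdeg (c := fun i => x (i, j) * (ζ ^ (j : ℕ)) ^ (i : ℕ)) ?_ ?_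
    · refine Function.ne_iff.mpr ⟨i, mul_ne_zero hij (pow_ne_zero _ (pow_ne_zero _ ?_))⟩
      exact hζ.ne_zero hp.ne_zero
    · rw [zero_mulVec] at h1
      simp only [map_mul, map_pow, mul_assoc, ← mul_pow]
      exact h1
  obtain ⟨e, he0, hep, y, hy⟩ := exists_prod_eq_pow_of_det_eq_zero σ
    (RingHom.ext fun y => by rw [hσi, hτp]; rfl) (cyclicShift_pow_self _)
    (by rw [← RingHom.mapMatrix_apply, cyclicShift_map]; exact congrArg _ (τ.commutes b))
    (by rw [hMσ, symbolMatrix_mul_cyclicShift]; rw [← map_pow, hζ.pow_eq_one, map_one])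
    (h L (algebraMap E L) α hαp) hM0
  have hNy : Algebra.norm E y = b ^ e := by
    apply (algebraMap E L).injective
    rw [hnorm, map_pow, ← hy]
    exact Finset.prod_congr rfl fun i _ => (hσi i y).symm
  have hy0 : y ≠ 0 := by
    rintro rfl
    rw [Algebra.norm_zero] at hNy
    exact pow_ne_zero e hb hNy.symm
  have h1 := natCast_dvd_sym_norm_mul hp hrank hαp hy0 ha
  rw [hNy, sym_pow hb, smul_mul_assoc] at h1
  exact natCast_dvd_of_dvd_nsmul (Nat.coprime_of_lt_prime he0.ne' hep hp).symm h1

end KummerExtension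

/-! ### Divisibility of symbols over fields with roots of unity -/

section ReducedNormValue

open Matrix

lemma symbolMatrix_sub {R : Type*} [CommRing R] {p : ℕ} (ζ u b : R) (x y : Fin p × Fin p → R) :
    symbolMatrix ζ u b (fun ij => x ij - y ij) = symbolMatrix ζ u b x - symbolMatrix ζ u b y := by
  simp only [symbolMatrix, sub_smul, Finset.sum_sub_distrib]

lemma symbolMatrix_single {R : Type*} [CommRing R] {p : ℕ} (hp : 0 < p) (ζ u b t : R) :
    symbolMatrix ζ u b (Pi.single (⟨0, hp⟩, ⟨0, hp⟩) t) = scalar (Fin p) t := by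
  rw [symbolMatrix, Finset.sum_eq_single (⟨0, hp⟩, ⟨0, hp⟩)]
  · simp [smul_one_eq_diagonal]
  · intro ij _ hij
    rw [Pi.single_eq_of_ne hij, zero_smul]
  · simp

open MilnorRing in
lemma natCast_dvd_sym_coeff_zero_mul {k : Type*} [Field k] {p : ℕ} {z : MilnorRing k}
    {f : Polynomial k} (hf : f.Monic) (hf0 : f.coeff 0 ≠ 0)
    (h : ∀ v : FinitePlace k, v.1 ∣ f → (p : MilnorRing k) ∣ sym ((-1) ^ v.deg * v.1.coeff 0) * z) :
    (p : MilnorRing k) ∣ sym ((-1) ^ f.natDegree * f.coeff 0) * z := by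
  induction hn : f.natDegree using Nat.strong_induction_on generalizing f with
  | _ n ih =>
    subst hn
    by_cases hu : IsUnit f
    · rw [hf.eq_one_of_isUnit hu]
      simp
    obtain ⟨g, hg, hgirr, q, rfl⟩ := Polynomial.exists_monic_irreducible_factor f hu
    have hq : q.Monic := hg.of_mul_monic_left hf
    rw [Polynomial.mul_coeff_zero] at hf0 ⊢
    have hg0 := left_ne_zero_of_mul hf0
    have hq0 := right_ne_zero_of_mul hf0
    have h1 : (p : MilnorRing k) ∣ sym ((-1) ^ g.natDegree * g.coeff 0) * z :=
      h ⟨g, hg, hgirr⟩ (dvd_mul_right g q)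
    rw [hg.natDegree_mul hq] at ih ⊢
    have h2 := ih q.natDegree (by have := hgirr.natDegree_pos; omega) hq hq0
      (fun v hv => h v (hv.mul_left g)) rfl
    rw [pow_add, mul_mul_mul_comm, sym_mul (by simp [hg0]) (by simp [hq0]), add_mul]
    exact dvd_add h1 h2

open MilnorRing in
/-- The cup product of a symbol with a nonzero value of its reduced norm form is divisible
by `p`. -/
theorem natCast_dvd_sym_eval_normForm_mul {k : Type u} [Field k] {p : ℕ} (hp : p.Prime) {ζ : k}
    (hζ : IsPrimitiveRoot ζ p) {a b : k} (ha : a ≠ 0) (hb : b ≠ 0) (x : Fin p × Fin p → k)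
    (hx : eval x (normForm p ζ a b) ≠ 0) :
    (p : MilnorRing k) ∣ sym (eval x (normForm p ζ a b)) * (sym b * sym a) := by
  set o : Fin p × Fin p := (⟨0, hp.pos⟩, ⟨0, hp.pos⟩) with ho
  set c := eval x (normForm p ζ a b) with hc
  let K := AlgebraicClosure k
  let φ : k →+* K := algebraMap k K
  obtain ⟨α, hα⟩ := IsAlgClosed.exists_pow_nat_eq (φ a) hp.pos
  have hcdet : φ c = (symbolMatrix (φ ζ) α (φ b) (φ ∘ x)).det := by
    rw [← eval₂_normForm hζ hp.pos hb a φ hα, hc, eval₂_comp]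
  by_cases hscal : ∀ ij, ij ≠ o → x ij = 0
  · have hcx : c = x o ^ p := by
      apply φ.injective
      have : φ ∘ x = Pi.single o (φ (x o)) := by
        ext ij
        by_cases hij : ij = o
        · simp [hij]
        · simp [Pi.single_eq_of_ne hij, hscal ij hij]
      rw [hcdet, this, symbolMatrix_single]
      simp
    rw [hcx] at hx ⊢
    rw [sym_pow (fun h => hx (by rw [h, zero_pow hp.ne_zero])), nsmul_eq_mul, mul_assoc]
    exact dvd_mul_right _ _
  push Not at hscal
  obtain ⟨ij, hijo, hij⟩ := hscal
  set y : Fin p × Fin p → Polynomial k := fun ij =>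
    (Pi.single o Polynomial.X : Fin p × Fin p → Polynomial k) ij - Polynomial.C (x ij) with hy
  set f : Polynomial k := (normForm p ζ a b).eval₂ Polynomial.C y with hf
  have hfmap : f.map φ = (symbolMatrix (φ ζ) α (φ b) (φ ∘ x)).charpoly := by
    have h1 : Polynomial.mapRingHom φ ∘ y = fun ij =>
        (Pi.single o Polynomial.X : Fin p × Fin p → Polynomial K) ij -
          (Polynomial.C ∘ φ ∘ x) ij := by
      ext1 ij
      by_cases hij : ij = o
      · simp [hy, hij]
      · simp [hy, Pi.single_eq_of_ne hij]
    rw [← Polynomial.coe_mapRingHom, hf, eval₂_comp_left, eval₂_normForm hζ hp.pos hb a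
      ((Polynomial.mapRingHom φ).comp Polynomial.C) (α := Polynomial.C α)
      (by rw [← map_pow, hα]; simp), h1, symbolMatrix_sub, symbolMatrix_single, Matrix.charpoly,
      charmatrix, symbolMatrix_map]
    simp
  have hmonic : f.Monic := by
    rw [← Polynomial.monic_map_iff (f := φ), hfmap]
    exact charpoly_monic _
  have hdeg : f.natDegree = p := by
    rw [← Polynomial.natDegree_map φ, hfmap, charpoly_natDegree_eq_dim, Fintype.card_fin]
  have hcf : (-1) ^ f.natDegree * f.coeff 0 = c := by
    apply φ.injective
    rw [hcdet, det_eq_sign_charpoly_coeff, ← hfmap, Polynomial.coeff_map, hdeg, Fintype.card_fin]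
    simp
  have hf0 : f.coeff 0 ≠ 0 := by
    intro h
    rw [h, mul_zero] at hcf
    exact hx hcf.symm
  rw [← hcf]
  refine natCast_dvd_sym_coeff_zero_mul hmonic hf0 fun v hv => ?_
  have hv0 : v.1.coeff 0 ≠ 0 := by
    obtain ⟨q, hq⟩ := hv
    rw [hq, Polynomial.mul_coeff_zero] at hf0
    exact left_ne_zero_of_mul hf0
  rw [← v.transfer_sym_root_mul hv0]
  refine AddMonoidHom.natCast_dvd_map _ (natCast_dvd_mul ?_ _)
  rw [map_mul, map_sym, map_sym]
  have hinj := (AdjoinRoot.of v.1).injective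
  refine natCast_dvd_sym_mul_sym hp (hζ.map_of_injective hinj)
    ((map_ne_zero_iff _ hinj).mpr ha) ((map_ne_zero_iff _ hinj).mpr hb)
    (x := AdjoinRoot.mk v.1 ∘ y) ?_ fun K' _ ψ β hβ => ?_
  · refine Function.ne_iff.mpr ⟨ij, ?_⟩
    simp [hy, Pi.single_eq_of_ne hijo, hij]
  · refine (eval₂_normForm hζ hp.pos hb a (ψ.comp (AdjoinRoot.of v.1)) hβ _).symm.trans ?_
    have h1 := eval₂_comp_left (ψ.comp (AdjoinRoot.mk v.1)) Polynomial.C y (normForm p ζ a b)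
    rw [← hf, RingHom.comp_apply, AdjoinRoot.mk_eq_zero.mpr hv, map_zero] at h1
    exact h1.symm

open MilnorRing in
/-- Over a `C₂` field containing a primitive `p`-th root of unity, symbols of length three are
divisible by `p`. -/
theorem IsCField.natCast_dvd_sym_mul_of_isPrimitiveRoot {k : Type u} [Field k]
    (hk : IsCField k 2) {p : ℕ} (hp : p.Prime) {ζ : k} (hζ : IsPrimitiveRoot ζ p) {a b c : k}
    (ha : a ≠ 0) (hb : b ≠ 0) (hc : c ≠ 0) :
    (p : MilnorRing k) ∣ sym c * (sym b * sym a) := by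
  have hQ : (rename some (normForm p ζ a b) -
      C c * X none ^ p : MvPolynomial (Option (Fin p × Fin p)) k).IsHomogeneous p := by
    refine (normForm_isHomogeneous hp.ne_zero ζ a b).rename_isHomogeneous.sub ?_
    simpa using (isHomogeneous_C (Option (Fin p × Fin p)) c).mul ((isHomogeneous_X k none).pow p)
  obtain ⟨x, hx, hxQ⟩ := hk.exists_eval_eq_zero hp.pos (by simp [sq]) hQ
  have heval : eval (x ∘ some) (normForm p ζ a b) = c * x none ^ p := by
    rw [map_sub, eval_rename, sub_eq_zero] at hxQ
    simpa using hxQ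
  by_cases ht : x none = 0
  · refine natCast_dvd_mul (natCast_dvd_sym_mul_sym hp hζ ha hb (x := x ∘ some) ?_
      fun K _ φ α hα => ?_) _
    · intro h0
      refine hx (funext fun i => ?_)
      cases i with
      | none => exact ht
      | some i => exact congrFun h0 i
    · rw [← eval₂_normForm hζ hp.pos hb a φ hα, ← eval₂_comp, heval, ht, zero_pow hp.ne_zero,
        mul_zero, map_zero]
  · have htp := pow_ne_zero p ht
    have h1 := natCast_dvd_sym_eval_normForm_mul hp hζ ha hb (x ∘ some)
      (by rw [heval]; exact mul_ne_zero hc htp)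
    rw [heval, sym_mul hc htp, sym_pow ht, nsmul_eq_mul, add_mul, mul_assoc] at h1
    exact (dvd_add_left (dvd_mul_right _ _)).mp h1

end ReducedNormValue

section MainTheorem

open MilnorRing

/-- Over a `C₂` field of characteristic different from `p`, symbols of length three are divisible
by `p`. -/
theorem IsCField.natCast_dvd_sym_mul {k : Type u} [Field k] (hk : IsCField k 2) {p : ℕ}
    (hp : p.Prime) (hpk : (p : k) ≠ 0) {a b c : k} (ha : a ≠ 0) (hb : b ≠ 0) (hc : c ≠ 0) :
    (p : MilnorRing k) ∣ sym c * (sym b * sym a) := by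
  have hcyc : ¬ IsUnit (Polynomial.cyclotomic p k) := fun h =>
    (Polynomial.degree_cyclotomic_pos p k hp.pos).ne' (Polynomial.degree_eq_zero_of_isUnit h)
  obtain ⟨g, hg, hgirr, hdvd⟩ := Polynomial.exists_monic_irreducible_factor _ hcyc
  obtain ⟨v, rfl⟩ : ∃ v : FinitePlace k, v.1 = g := ⟨⟨g, hg, hgirr⟩, rfl⟩
  have hdeg : v.deg < p := by
    have h1 := Polynomial.natDegree_le_of_dvd hdvd (Polynomial.cyclotomic_ne_zero p k)
    rw [Polynomial.natDegree_cyclotomic, Nat.totient_prime hp] at h1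
    have := hp.pos
    rw [FinitePlace.deg]
    omega
  have hinj := (AdjoinRoot.of v.1).injective
  have hroot : IsPrimitiveRoot (AdjoinRoot.root v.1) p := by
    have : NeZero ((p : ℕ) : v.ResidueField) := ⟨by
      rw [← map_natCast (AdjoinRoot.of v.1)]
      exact (map_ne_zero_iff _ hinj).mpr hpk⟩
    rw [← Polynomial.isRoot_cyclotomic_iff, ← Polynomial.map_cyclotomic p (AdjoinRoot.of v.1),
      Polynomial.IsRoot.def, Polynomial.eval_map]
    exact Polynomial.eval₂_eq_zero_of_dvd_of_eval₂_eq_zero _ _ hdvd (AdjoinRoot.eval₂_root v.1)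
  have hfd : FiniteDimensional k v.ResidueField := (AdjoinRoot.powerBasis hg.ne_zero).finite
  have h1 := (IsCField.of_finite (E := v.ResidueField) hk).natCast_dvd_sym_mul_of_isPrimitiveRoot hp
    hroot ((map_ne_zero_iff _ hinj).mpr ha) ((map_ne_zero_iff _ hinj).mpr hb)
    ((map_ne_zero_iff _ hinj).mpr hc)
  have h2 := v.transfer.natCast_dvd_map h1
  rw [← map_sym _ hinj, ← map_sym _ hinj, ← map_sym _ hinj, ← map_mul, ← map_mul,
    v.transfer_map] at h2
  exact natCast_dvd_of_dvd_nsmul (Nat.coprime_of_lt_prime v.deg_pos.ne' hdeg hp).symm h2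

end MainTheorem

/-- If `F` has the `C_2` property and `p` is a prime not equal
to the characteristic of `F`, then `K_3^M(F)/pK_3^M(F) = 0`. -/
theorem kMod_three_eq_zero (F : Type u) [Field F] (p : ℕ) (hp : p.Prime)
    (hchar : ringChar F ≠ p) (hC : IsCField F 2) :
    ∀ α : kMod F p 3, α = 0 := by
  have hpF : (p : F) ≠ 0 := fun h =>
    ((Nat.dvd_prime hp).mp (ringChar.dvd h)).elim CharP.ringChar_ne_one hchar
  intro α
  induction α using kMod_induction p with
  | h0 => rfl
  | hs a =>
    obtain ⟨z, hz⟩ := hC.natCast_dvd_sym_mul hp hpF (a 2).ne_zero (a 1).ne_zero (a 0).ne_zero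
    have h := symbol_eq_zero_of_eq_nsmul p (a 0) (a 1) (a 2) z (by rw [hz, nsmul_eq_mul])
    rwa [show ![a 0, a 1, a 2] = a from List.ofFn_injective rfl] at h
  | hneg x hx => rw [hx, neg_zero]
  | hadd x y hx hy => rw [hx, hy, add_zero]
end
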